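/- arXiv:1805.08554 — 10 statements merged into one kernel-verified Lean document; each statement's English description precedes it below -/
import Mathlib

section
/- Let d, k ∈ ℕ with 1 ≤ d ≤ k, let G be a d-hypergraph with edge-weight function w : E(G) → ℕ, let S ⊆ V(G) with |S| = k, and let t, q ∈ ℕ with q ≥ 2. Write E_S = {e ∈ E(G) : e ⊆ S}. Then t = Σ_{e ∈ E_S} w(e) holds if and only if there exists a sequence c_0, c_1, c_2, … of integers with c_0 = 0 and 0 ≤ c_ℓ ≤ 2·binom(k,≤d) for all ℓ ∈ ℕ, such that for every ℓ ∈ ℕ the linear equation q·c_{ℓ+1} + t_ℓ = c_ℓ + Σ_{e ∈ E_S} (w(e))_ℓ holds, where t_ℓ and (w(e))_ℓ denote the ℓ-th digits of t and w(e) in base q. -/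
/-- The ℓ-th digit of `N` in base `q`. -/
def digit (q N ℓ : ℕ) : ℕ := N / q ^ ℓ % q

/-- `binomLe k d = Σ_{i=0}^d C(k,i)`, the number of subsets of size at most `d`
of a `k`-element set. -/
def binomLe (k d : ℕ) : ℕ := ∑ i ∈ Finset.range (d + 1), k.choose i

theorem mul_div_pow_succ_add_digit (q N l : ℕ) :
    (q : ℤ) * (N / q ^ (l + 1) : ℕ) + (digit q N l : ℤ) = (N / q ^ l : ℕ) := by
  rw [digit, pow_succ, ← Nat.div_div_eq_div_mul]
  exact_mod_cast Nat.div_add_mod (N / q ^ l) q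

theorem sum_div_le_sum_div {ι : Type*} (s : Finset ι) (f : ι → ℕ) {m : ℕ} (hm : 0 < m) :
    ∑ i ∈ s, f i / m ≤ (∑ i ∈ s, f i) / m := by
  rw [Nat.le_div_iff_mul_le hm, Finset.sum_mul]
  exact Finset.sum_le_sum fun i _ => Nat.div_mul_le_self _ _

theorem sum_div_le_sum_div_add_card {ι : Type*} (s : Finset ι) (f : ι → ℕ) {m : ℕ} (hm : 0 < m) :
    (∑ i ∈ s, f i) / m ≤ ∑ i ∈ s, f i / m + s.card := by
  apply Nat.div_le_of_le_mul
  rw [Finset.card_eq_sum_ones, ← Finset.sum_add_distrib, Finset.mul_sum]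
  exact Finset.sum_le_sum fun i _ => (Nat.lt_mul_div_succ _ hm).le

/-- A family of subsets of size at most `d` of a finite set `S` has at most
`binomLe S.card d` members. -/
theorem card_le_binomLe {α : Type*} [DecidableEq α] (F : Finset (Finset α)) (S : Finset α) (d : ℕ)
    (hF : ∀ e ∈ F, e ⊆ S ∧ e.card ≤ d) : F.card ≤ binomLe S.card d := by
  have hsub : F ⊆ (Finset.range (d + 1)).biUnion fun i => S.powersetCard i := by
    intro e he
    simp only [Finset.mem_biUnion, Finset.mem_range, Finset.mem_powersetCard]
    exact ⟨e.card, Nat.lt_succ_of_le (hF e he).2, (hF e he).1, rfl⟩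
  refine (Finset.card_le_card hsub).trans (Finset.card_biUnion_le.trans ?_)
  simp [binomLe]

/-- Lemma 3 (i) ⇔ (ii): with `E_S = {e ∈ E(G) : e ⊆ S}`, we have
`t = Σ_{e ∈ E_S} w(e)` iff there are carries `c_0 = 0`, `0 ≤ c_ℓ ≤ 2·binom(k,≤d)`,
satisfying the linear equations `q·c_{ℓ+1} + t_ℓ = c_ℓ + Σ_{e ∈ E_S} (w(e))_ℓ`
for all `ℓ`, where subscript `ℓ` denotes the ℓ-th digit in base `q`. -/
theorem stmt0 {α : Type*} [DecidableEq α] (d k : ℕ) (hd : 1 ≤ d) (hdk : d ≤ k)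
    (V : Finset α) (E : Finset (Finset α))
    (hE : ∀ e ∈ E, e ⊆ V ∧ e.card ≤ d)
    (w : Finset α → ℕ) (S : Finset α) (hSV : S ⊆ V) (hS : S.card = k)
    (t q : ℕ) (hq : 2 ≤ q) :
    t = ∑ e ∈ E.filter (fun e => e ⊆ S), w e ↔
      ∃ c : ℕ → ℤ, c 0 = 0 ∧
        (∀ ℓ, 0 ≤ c ℓ ∧ c ℓ ≤ 2 * (binomLe k d : ℤ)) ∧
        (∀ ℓ, (q : ℤ) * c (ℓ + 1) + (digit q t ℓ : ℤ) =
          c ℓ + ∑ e ∈ E.filter (fun e => e ⊆ S), (digit q (w e) ℓ : ℤ)) := by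
  set F := E.filter (fun e => e ⊆ S)
  have hF : F.card ≤ binomLe k d := by
    rw [← hS]
    refine card_le_binomLe F S d fun e he => ?_
    exact ⟨(Finset.mem_filter.1 he).2, (hE e (Finset.mem_filter.1 he).1).2⟩
  have hdig : ∀ l, (q : ℤ) * ∑ e ∈ F, ((w e / q ^ (l + 1) : ℕ) : ℤ)
      + ∑ e ∈ F, (digit q (w e) l : ℤ) = ∑ e ∈ F, ((w e / q ^ l : ℕ) : ℤ) := by
    intro l
    rw [Finset.mul_sum, ← Finset.sum_add_distrib]
    exact Finset.sum_congr rfl fun e _ => mul_div_pow_succ_add_digit q (w e) l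
  constructor
  · intro ht
    refine ⟨fun l => ((t / q ^ l : ℕ) : ℤ) - ∑ e ∈ F, ((w e / q ^ l : ℕ) : ℤ), ?_, ?_, ?_⟩
    · simp [ht]
    · intro l
      have hm : 0 < q ^ l := by positivity
      have h1 := sum_div_le_sum_div F w hm
      have h2 := sum_div_le_sum_div_add_card F w hm
      rw [← ht] at h1 h2
      dsimp only
      rw [← Nat.cast_sum]
      constructor <;> omega
    · intro l
      linear_combination mul_div_pow_succ_add_digit q t l - hdig l
  · rintro ⟨c, hc0, -, hc⟩
    have key : ∀ l, (∑ e ∈ F, (w e : ℤ)) - t =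
        q ^ l * (c l - (t / q ^ l : ℕ) + ∑ e ∈ F, ((w e / q ^ l : ℕ) : ℤ)) := by
      intro l
      induction l with
      | zero => simp [hc0]; ring
      | succ l ih =>
        rw [ih]
        linear_combination (q : ℤ) ^ l *
          (mul_div_pow_succ_add_digit q t l - hdig l - hc l)
    have hlt : t + ∑ e ∈ F, w e < q ^ (t + ∑ e ∈ F, w e) := Nat.lt_pow_self hq
    have hzero : (∑ e ∈ F, (w e : ℤ)) - t = 0 := by
      refine Int.eq_zero_of_abs_lt_dvd (Dvd.intro _ (key (t + ∑ e ∈ F, w e)).symm) ?_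
      rw [← Nat.cast_sum, ← Nat.cast_pow, abs_lt]
      constructor <;> omega
    rw [← Nat.cast_sum] at hzero
    omega
end

section
/- Let d ∈ ℕ with d ≥ 1, let V be a finite set and S ⊆ V, let w assign to every subset e ⊆ V with |e| ≤ d a natural number w(e), let t ∈ ℕ, let q ≥ 2, let P ∈ ℕ, and let c_0, c_1, …, c_P ∈ ℤ be arbitrary integers. For 0 ≤ ℓ ≤ P−1 set a_ℓ = c_ℓ − t_ℓ − q·c_{ℓ+1} and b_ℓ = Σ_{e ⊆ S, |e| ≤ d} (w(e))_ℓ, where t_ℓ and (w(e))_ℓ denote the ℓ-th digits of t and w(e) in base q. For every f ⊆ V with |f| ≤ 2d define w'(f) = Σ_{ℓ=0}^{P−1} ( 2·[|f| ≤ d]·(w(f))_ℓ·a_ℓ + Σ_{(e₁,e₂)} (w(e₁))_ℓ·(w(e₂))_ℓ ), where the inner sum is over all ordered pairs (e₁,e₂) of subsets of V with |e₁| ≤ d, |e₂| ≤ d and e₁ ∪ e₂ = f, and [|f| ≤ d] is 1 if |f| ≤ d and 0 otherwise; define t' = −Σ_{ℓ=0}^{P−1} a_ℓ². Then Σ_{f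 ⊆ S, |f| ≤ 2d} w'(f) − t' = Σ_{ℓ=0}^{P−1} (a_ℓ + b_ℓ)². -/
/-- `aSeq q t c ℓ = c_ℓ − t_ℓ − q·c_{ℓ+1}`. -/
def aSeq (q t : ℕ) (c : ℕ → ℤ) (ℓ : ℕ) : ℤ :=
  c ℓ - (digit q t ℓ : ℤ) - (q : ℤ) * c (ℓ + 1)

/-- `bSeq d q S w ℓ = Σ_{e ⊆ S, |e| ≤ d} (w(e))_ℓ`. -/
def bSeq {α : Type*} [DecidableEq α] (d q : ℕ) (S : Finset α) (w : Finset α → ℕ)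
    (ℓ : ℕ) : ℤ :=
  ∑ e ∈ S.powerset.filter (fun e => e.card ≤ d), (digit q (w e) ℓ : ℤ)

/-- The new weight function:
`w'(f) = Σ_{ℓ=0}^{P−1} ( 2·[|f| ≤ d]·(w(f))_ℓ·a_ℓ + Σ_{e₁ ∪ e₂ = f} (w(e₁))_ℓ·(w(e₂))_ℓ )`,
where the inner sum is over ordered pairs of subsets of `V` of size at most `d`. -/
def wPrime {α : Type*} [DecidableEq α] (d q t P : ℕ) (V : Finset α)
    (w : Finset α → ℕ) (c : ℕ → ℤ) (f : Finset α) : ℤ :=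
  ∑ ℓ ∈ Finset.range P,
    (2 * (if f.card ≤ d then 1 else 0) * (digit q (w f) ℓ : ℤ) * aSeq q t c ℓ +
      ∑ p ∈ ((V.powerset.filter (fun e => e.card ≤ d)) ×ˢ
          (V.powerset.filter (fun e => e.card ≤ d))).filter
          (fun p => p.1 ∪ p.2 = f),
        (digit q (w p.1) ℓ : ℤ) * (digit q (w p.2) ℓ : ℤ))

/-- The new target: `t' = −Σ_{ℓ=0}^{P−1} a_ℓ²`. -/
def tPrime (q t P : ℕ) (c : ℕ → ℤ) : ℤ :=
  -∑ ℓ ∈ Finset.range P, (aSeq q t c ℓ) ^ 2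

/-- Summing the indicator of `|f| ≤ d` against `g` over `f ⊆ S`, `|f| ≤ 2d`. -/
theorem sum_indicator_card_le {α : Type*} [DecidableEq α] (d : ℕ) (S : Finset α)
    (g : Finset α → ℤ) (a : ℤ) :
    ∑ f ∈ S.powerset.filter (fun f => f.card ≤ 2 * d),
        2 * (if f.card ≤ d then 1 else 0) * g f * a =
      2 * a * ∑ e ∈ S.powerset.filter (fun e => e.card ≤ d), g e := by
  have hfilter : S.powerset.filter (fun e => e.card ≤ d) =
      (S.powerset.filter (fun f => f.card ≤ 2 * d)).filter (fun e => e.card ≤ d) := by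
    ext e
    simp only [Finset.mem_filter, Finset.mem_powerset]
    constructor
    · rintro ⟨h₁, h₂⟩
      exact ⟨⟨h₁, by omega⟩, h₂⟩
    · rintro ⟨⟨h₁, _⟩, h₂⟩
      exact ⟨h₁, h₂⟩
  rw [hfilter, Finset.sum_filter _ (fun e => g e), Finset.mul_sum]
  refine Finset.sum_congr rfl fun f _ => ?_
  split_ifs <;> ring

/-- Grouping ordered pairs of small subsets by their union: only pairs of subsets of `S`
contribute to unions contained in `S`. -/
theorem sum_union_fibers_eq_sq {α : Type*} [DecidableEq α] (d : ℕ) {V S : Finset α}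
    (hS : S ⊆ V) (g : Finset α → ℤ) :
    ∑ f ∈ S.powerset.filter (fun f => f.card ≤ 2 * d),
        ∑ p ∈ ((V.powerset.filter (fun e => e.card ≤ d)) ×ˢ
          (V.powerset.filter (fun e => e.card ≤ d))).filter
          (fun p => p.1 ∪ p.2 = f), g p.1 * g p.2 =
      (∑ e ∈ S.powerset.filter (fun e => e.card ≤ d), g e) ^ 2 := by
  rw [sq, Finset.sum_mul_sum, ← Finset.sum_product',
    ← Finset.sum_fiberwise_of_maps_to
      (s := S.powerset.filter (fun e => e.card ≤ d) ×ˢ S.powerset.filter (fun e => e.card ≤ d))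
      (t := S.powerset.filter (fun f => f.card ≤ 2 * d))
      (g := fun p : Finset α × Finset α => p.1 ∪ p.2)]
  · refine Finset.sum_congr rfl fun f hf => Finset.sum_congr ?_ fun _ _ => rfl
    have hfS : f ⊆ S := Finset.mem_powerset.mp (Finset.mem_filter.mp hf).1
    ext ⟨e₁, e₂⟩
    simp only [Finset.mem_filter, Finset.mem_product, Finset.mem_powerset]
    constructor
    · rintro ⟨⟨⟨_, h₁⟩, ⟨_, h₂⟩⟩, rfl⟩
      exact ⟨⟨⟨Finset.union_subset_left hfS, h₁⟩, ⟨Finset.union_subset_right hfS, h₂⟩⟩, rfl⟩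
    · rintro ⟨⟨⟨s₁, h₁⟩, ⟨s₂, h₂⟩⟩, h⟩
      exact ⟨⟨⟨s₁.trans hS, h₁⟩, ⟨s₂.trans hS, h₂⟩⟩, h⟩
  · rintro ⟨e₁, e₂⟩ hp
    simp only [Finset.mem_filter, Finset.mem_product, Finset.mem_powerset] at hp ⊢
    refine ⟨Finset.union_subset hp.1.1 hp.2.1, ?_⟩
    have := Finset.card_union_le e₁ e₂
    omega

/-- `Σ_{f ⊆ S, |f| ≤ 2d} w'(f) − t' = Σ_{ℓ=0}^{P−1} (a_ℓ + b_ℓ)²`. -/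
theorem stmt2 {α : Type*} [DecidableEq α] (d : ℕ) (hd : 1 ≤ d)
    (V S : Finset α) (hS : S ⊆ V)
    (w : Finset α → ℕ) (t q P : ℕ) (hq : 2 ≤ q) (c : ℕ → ℤ) :
    (∑ f ∈ S.powerset.filter (fun f => f.card ≤ 2 * d),
        wPrime d q t P V w c f) - tPrime q t P c =
      ∑ ℓ ∈ Finset.range P, (aSeq q t c ℓ + bSeq d q S w ℓ) ^ 2 := by
  unfold wPrime tPrime
  rw [Finset.sum_comm, sub_neg_eq_add, ← Finset.sum_add_distrib]
  refine Finset.sum_congr rfl fun ℓ _ => ?_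
  rw [Finset.sum_add_distrib,
    sum_indicator_card_le d S (fun e => (digit q (w e) ℓ : ℤ)) (aSeq q t c ℓ),
    sum_union_fibers_eq_sq d hS (fun e => (digit q (w e) ℓ : ℤ))]
  unfold bSeq
  ring
end

section
/- Let d, k ∈ ℕ with 1 ≤ d ≤ k, let V be a finite set, let w assign to every subset e ⊆ V with |e| ≤ d a natural number w(e), let t ∈ ℕ, let q ≥ 2, and let P ∈ ℕ be such that t < q^P and w(e) < q^P for every e. For a sequence c = (c_0,…,c_P) of integers and 0 ≤ ℓ ≤ P−1 set a_ℓ = c_ℓ − t_ℓ − q·c_{ℓ+1}, where t_ℓ denotes the ℓ-th digit of t in base q; for f ⊆ V with |f| ≤ 2d define w'_c(f) = Σ_{ℓ=0}^{P−1} ( 2·[|f| ≤ d]·(w(f))_ℓ·a_ℓ + Σ_{(e₁,e₂)} (w(e₁))_ℓ·(w(e₂))_ℓ ), where the inner sum is over all ordered pairs (e₁,e₂) of subsets of V with |e₁| ≤ d, |e₂| ≤ d and e₁ ∪ e₂ = f; and define t'_c = −Σ_{ℓ=0}^{P−1} a_ℓ². Then for every S ⊆ V with |S| = k the following are equivalent: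 (i) Σ_{e ⊆ S, |e| ≤ d} w(e) = t; (ii) there exists a sequence c = (c_0,…,c_P) of integers with c_0 = c_P = 0 and 0 ≤ c_ℓ ≤ 2·binom(k,≤d) for all 0 ≤ ℓ ≤ P, such that Σ_{f ⊆ S, |f| ≤ 2d} w'_c(f) = t'_c. -/
/-- The subsets of `S` of size at most `d`. -/
abbrev smallSubsets {α : Type*} (S : Finset α) (d : ℕ) : Finset (Finset α) :=
  S.powerset.filter (fun e => e.card ≤ d)

/-- The carry into position `ℓ` when the numbers `w e`, `e ∈ E`, are added in base `q`. -/
def carry {ι : Type*} (q : ℕ) (w : ι → ℕ) (E : Finset ι) (ℓ : ℕ) : ℕ :=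
  (∑ e ∈ E, w e % q ^ ℓ) / q ^ ℓ

theorem mod_pow_succ_eq_add_digit (q N ℓ : ℕ) :
    N % q ^ (ℓ + 1) = N % q ^ ℓ + q ^ ℓ * digit q N ℓ :=
  Nat.mod_pow_succ

theorem sum_pow_mul_digit (q N P : ℕ) :
    ∑ ℓ ∈ Finset.range P, q ^ ℓ * digit q N ℓ = N % q ^ P := by
  induction P with
  | zero => simp [Nat.mod_one]
  | succ P ih => rw [Finset.sum_range_succ, ih, mod_pow_succ_eq_add_digit]

theorem carry_le {ι : Type*} {q : ℕ} (hq : 0 < q) (w : ι → ℕ) (E : Finset ι) (ℓ : ℕ) :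
    carry q w E ℓ ≤ E.card := by
  have hpos : 0 < q ^ ℓ := pow_pos hq ℓ
  refine Nat.div_le_of_le_mul ?_
  rw [mul_comm]
  exact Finset.sum_le_card_nsmul E _ _ fun e _ => (Nat.mod_lt _ hpos).le

theorem pow_mul_carry_add {ι : Type*} (q : ℕ) (w : ι → ℕ) (E : Finset ι) (ℓ : ℕ) :
    q ^ ℓ * carry q w E ℓ + (∑ e ∈ E, w e) % q ^ ℓ = ∑ e ∈ E, w e % q ^ ℓ := by
  rw [Finset.sum_nat_mod, carry, Nat.div_add_mod]

theorem carry_recurrence {ι : Type*} {q : ℕ} (hq : 0 < q) (w : ι → ℕ) (E : Finset ι) (ℓ : ℕ) :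
    (∑ e ∈ E, digit q (w e) ℓ) + carry q w E ℓ =
      digit q (∑ e ∈ E, w e) ℓ + q * carry q w E (ℓ + 1) := by
  have h₀ := pow_mul_carry_add q w E ℓ
  have h₁ := pow_mul_carry_add q w E (ℓ + 1)
  simp only [mod_pow_succ_eq_add_digit, Finset.sum_add_distrib, ← Finset.mul_sum] at h₁
  refine Nat.eq_of_mul_eq_mul_left (pow_pos hq ℓ) ?_
  rw [pow_succ] at h₁
  linarith

theorem card_smallSubsets {α : Type*} [DecidableEq α] (S : Finset α) (d : ℕ) :
    (smallSubsets S d).card = binomLe S.card d := by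
  rw [binomLe, Finset.card_eq_sum_card_fiberwise (f := Finset.card) (t := Finset.range (d + 1))]
  · refine Finset.sum_congr rfl fun i hi => ?_
    rw [← Finset.card_powersetCard]
    congr 1
    ext e
    simp only [Finset.mem_filter, Finset.mem_powerset, Finset.mem_powersetCard,
      Finset.mem_range] at hi ⊢
    constructor
    · tauto
    · rintro ⟨h, rfl⟩
      exact ⟨⟨h, by omega⟩, rfl⟩
  · intro e he
    simp only [Finset.coe_filter, Set.mem_ofPred_eq, Finset.coe_range, Set.mem_Iio] at he ⊢
    omega

/-- Each ordered pair of small subsets of `S` has exactly one union, a subset of `S`. -/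
theorem sum_pairs_union_eq {α M : Type*} [DecidableEq α] [CommSemiring M] (d : ℕ)
    {S V : Finset α} (hSV : S ⊆ V) (g : Finset α → M) :
    ∑ f ∈ smallSubsets S (2 * d),
      ∑ p ∈ (smallSubsets V d ×ˢ smallSubsets V d).filter (fun p => p.1 ∪ p.2 = f),
        g p.1 * g p.2 = (∑ e ∈ smallSubsets S d, g e) ^ 2 := by
  rw [sq, Finset.sum_mul_sum, ← Finset.sum_product',
    ← Finset.sum_fiberwise_of_maps_to (s := smallSubsets S d ×ˢ smallSubsets S d)
      (t := smallSubsets S (2 * d))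
      (g := fun p : Finset α × Finset α => p.1 ∪ p.2)]
  · refine Finset.sum_congr rfl fun f hf => Finset.sum_congr ?_ fun _ _ => rfl
    ext ⟨a, b⟩
    simp only [Finset.mem_filter, Finset.mem_powerset, Finset.mem_product] at hf ⊢
    constructor
    · rintro ⟨⟨⟨-, ha⟩, -, hb⟩, rfl⟩
      obtain ⟨h₁, h₂⟩ := Finset.union_subset_iff.1 hf.1
      exact ⟨⟨⟨h₁, ha⟩, h₂, hb⟩, rfl⟩
    · rintro ⟨⟨⟨h₁, ha⟩, h₂, hb⟩, h⟩
      exact ⟨⟨⟨h₁.trans hSV, ha⟩, h₂.trans hSV, hb⟩, h⟩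
  · rintro ⟨a, b⟩ h
    simp only [Finset.mem_filter, Finset.mem_powerset, Finset.mem_product] at h ⊢
    exact ⟨Finset.union_subset h.1.1 h.2.1, (Finset.card_union_le a b).trans (by omega)⟩

theorem sum_wPrime_sub_tPrime {α : Type*} [DecidableEq α] (d q t P : ℕ) (V : Finset α)
    (w : Finset α → ℕ) (c : ℕ → ℤ) {S : Finset α} (hSV : S ⊆ V) :
    ∑ f ∈ smallSubsets S (2 * d), wPrime d q t P V w c f - tPrime q t P c =
      ∑ ℓ ∈ Finset.range P,
        (∑ e ∈ smallSubsets S d, (digit q (w e) ℓ : ℤ) + aSeq q t c ℓ) ^ 2 := by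
  have hlin (ℓ : ℕ) : ∑ f ∈ smallSubsets S (2 * d),
      2 * (if f.card ≤ d then 1 else 0) * (digit q (w f) ℓ : ℤ) * aSeq q t c ℓ =
        2 * (∑ e ∈ smallSubsets S d, (digit q (w e) ℓ : ℤ)) * aSeq q t c ℓ := by
    have hfil : smallSubsets S d = (smallSubsets S (2 * d)).filter (fun e => e.card ≤ d) := by
      ext e
      simp only [Finset.mem_filter]
      grind
    rw [hfil, Finset.sum_filter (s := smallSubsets S (2 * d)), Finset.mul_sum, Finset.sum_mul]
    refine Finset.sum_congr rfl fun f _ => ?_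
    split_ifs <;> ring
  simp only [wPrime, tPrime]
  rw [Finset.sum_comm, sub_neg_eq_add, ← Finset.sum_add_distrib]
  refine Finset.sum_congr rfl fun ℓ _ => ?_
  rw [Finset.sum_add_distrib, hlin, sum_pairs_union_eq d hSV (fun e => (digit q (w e) ℓ : ℤ))]
  ring

/-- For every `S ⊆ V` with `|S| = k`: `Σ_{e ⊆ S, |e| ≤ d} w(e) = t` iff there is a
carry sequence `c = (c_0, …, c_P)` with `c_0 = c_P = 0` and
`0 ≤ c_ℓ ≤ 2·binom(k,≤d)`, such that `Σ_{f ⊆ S, |f| ≤ 2d} w'_c(f) = t'_c`. -/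
theorem stmt3 {α : Type*} [DecidableEq α] (d k : ℕ) (hd : 1 ≤ d) (hdk : d ≤ k)
    (V : Finset α) (w : Finset α → ℕ) (t q P : ℕ) (hq : 2 ≤ q)
    (ht : t < q ^ P)
    (hw : ∀ e ∈ V.powerset.filter (fun e => e.card ≤ d), w e < q ^ P)
    (S : Finset α) (hSV : S ⊆ V) (hS : S.card = k) :
    (∑ e ∈ S.powerset.filter (fun e => e.card ≤ d), w e = t) ↔
      ∃ c : ℕ → ℤ, c 0 = 0 ∧ c P = 0 ∧
        (∀ ℓ ≤ P, 0 ≤ c ℓ ∧ c ℓ ≤ 2 * (binomLe k d : ℤ)) ∧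
        ∑ f ∈ S.powerset.filter (fun f => f.card ≤ 2 * d), wPrime d q t P V w c f =
          tPrime q t P c := by
  have key := sum_wPrime_sub_tPrime d q t P V w
  constructor
  · intro hsum
    exact ⟨fun ℓ => (carry q w (smallSubsets S d) ℓ : ℤ), by simp [carry, Nat.mod_one],
      by
        have : ∑ e ∈ smallSubsets S d, w e % q ^ P = t := by
          rw [← hsum]
          exact Finset.sum_congr rfl fun e he =>
            Nat.mod_eq_of_lt (hw e (Finset.filter_subset_filter _ (Finset.powerset_mono.2 hSV) he))
        simp [carry, this, Nat.div_eq_of_lt ht],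
      fun ℓ _ => ⟨by positivity, by
        have h := carry_le (by omega : 0 < q) w (smallSubsets S d) ℓ
        rw [card_smallSubsets, hS] at h
        dsimp only
        omega⟩,
      by
        rw [← sub_eq_zero, key _ hSV]
        refine Finset.sum_eq_zero fun ℓ _ => ?_
        have h := carry_recurrence (by omega : 0 < q) w (smallSubsets S d) ℓ
        rw [show ∑ e ∈ smallSubsets S d, w e = t from hsum] at h
        rw [sq_eq_zero_iff, aSeq]
        have h' : (∑ e ∈ smallSubsets S d, (digit q (w e) ℓ : ℤ)) +
            carry q w (smallSubsets S d) ℓ =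
              digit q t ℓ + q * carry q w (smallSubsets S d) (ℓ + 1) := by
          exact_mod_cast h
        linarith⟩
  · rintro ⟨c, h0, hP, -, hc⟩
    rw [← sub_eq_zero, key _ hSV, Finset.sum_eq_zero_iff_of_nonneg fun _ _ => sq_nonneg _] at hc
    have htel : ∑ ℓ ∈ Finset.range P, (q : ℤ) ^ ℓ * aSeq q t c ℓ = -t := by
      have ht' : ∑ ℓ ∈ Finset.range P, (q : ℤ) ^ ℓ * digit q t ℓ = t := by
        exact_mod_cast (sum_pow_mul_digit q t P).trans (Nat.mod_eq_of_lt ht)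
      have hs := Finset.sum_range_sub (fun ℓ => (q : ℤ) ^ ℓ * c ℓ) P
      simp only [h0, hP, mul_zero, sub_zero] at hs
      rw [← ht', ← add_zero (-_), ← neg_zero, ← hs, ← neg_add, ← Finset.sum_add_distrib,
        ← Finset.sum_neg_distrib]
      refine Finset.sum_congr rfl fun ℓ _ => ?_
      rw [aSeq]
      ring
    have hw' : ∑ ℓ ∈ Finset.range P,
        (q : ℤ) ^ ℓ * ∑ e ∈ smallSubsets S d, (digit q (w e) ℓ : ℤ) =
          ∑ e ∈ smallSubsets S d, (w e : ℤ) := by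
      simp_rw [Finset.mul_sum]
      rw [Finset.sum_comm]
      refine Finset.sum_congr rfl fun e he => ?_
      exact_mod_cast (sum_pow_mul_digit q (w e) P).trans (Nat.mod_eq_of_lt
        (hw e (Finset.filter_subset_filter _ (Finset.powerset_mono.2 hSV) he)))
    have hzero : ∑ ℓ ∈ Finset.range P, ((q : ℤ) ^ ℓ *
        (∑ e ∈ smallSubsets S d, (digit q (w e) ℓ : ℤ)) + (q : ℤ) ^ ℓ * aSeq q t c ℓ) = 0 :=
      Finset.sum_eq_zero fun ℓ hℓ => by rw [← mul_add, sq_eq_zero_iff.1 (hc ℓ hℓ), mul_zero]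
    rw [Finset.sum_add_distrib, htel, hw'] at hzero
    have : ∑ e ∈ smallSubsets S d, (w e : ℤ) = t := by linarith
    exact_mod_cast this
end

section
/- Let d, k ∈ ℕ with 1 ≤ d ≤ k, let G be a d-hypergraph with edge-weight function w : E(G) → ℤ and target t ∈ ℤ, let M = max({|t|} ∪ {|w(e)| : e ∈ E(G)}) and B = binom(k,≤d). Define w'(e) for every subset e ⊆ V(G) with |e| ≤ d by w'(e) = w(e) if e ∈ E(G), and w'(e) = B·M + 1 otherwise. Then G has a k-clique of weight t with respect to w if and only if there exists a set S ⊆ V(G) with |S| = k such that Σ_{e ⊆ S, |e| ≤ d} w'(e) = t. -/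
theorem card_powerset_filter_card_le {α : Type*} (S : Finset α) (d : ℕ) :
    (S.powerset.filter (fun e => e.card ≤ d)).card = binomLe S.card d := by
  rw [binomLe, Finset.card_eq_sum_card_fiberwise (f := Finset.card) (t := Finset.range (d + 1))]
  · refine Finset.sum_congr rfl fun i hi => ?_
    rw [← Finset.card_powersetCard]
    congr 1
    ext e
    simp only [Finset.mem_filter, Finset.mem_powerset, Finset.mem_powersetCard, Finset.mem_range]
      at hi ⊢
    constructor
    · rintro ⟨⟨h, -⟩, h'⟩
      exact ⟨h, h'⟩
    · rintro ⟨h, h'⟩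
      exact ⟨⟨h, by omega⟩, h'⟩
  · intro e he
    simp only [Finset.coe_filter, Set.mem_ofPred_eq, Finset.coe_range, Set.mem_Iio] at he ⊢
    omega

theorem lt_sum_of_large_term {ι : Type*} (s : Finset ι) (f : ι → ℤ) (M : ℤ)
    (hf : ∀ i ∈ s, -M ≤ f i) {j : ι} (hj : j ∈ s) (hfj : (s.card : ℤ) * M < f j) :
    M < ∑ i ∈ s, f i := by
  have h : f j + M ≤ ∑ i ∈ s, (f i + M) :=
    Finset.single_le_sum (f := fun i => f i + M) (fun i hi => by linarith [hf i hi]) hj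
  rw [Finset.sum_add_distrib, Finset.sum_const, nsmul_eq_mul] at h
  linarith

/-- "Make complete": with `M` the maximum of `|t|` and the `|w(e)|`, and
`w'(e) = w(e)` for `e ∈ E(G)` and `w'(e) = B·M + 1` otherwise (`B = binom(k,≤d)`),
the hypergraph `G` has a `k`-clique of weight `t` (w.r.t. `w`) iff some `S ⊆ V(G)`
with `|S| = k` satisfies `Σ_{e ⊆ S, |e| ≤ d} w'(e) = t`. -/
theorem stmt4 {α : Type*} [DecidableEq α] (d k : ℕ) (hd : 1 ≤ d) (hdk : d ≤ k)
    (V : Finset α) (E : Finset (Finset α))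
    (hE : ∀ e ∈ E, e ⊆ V ∧ e.card ≤ d)
    (w : Finset α → ℤ) (t : ℤ) (M : ℤ)
    (hM : M = (insert |t| (E.image fun e => |w e|)).max' (Finset.insert_nonempty _ _)) :
    (∃ S ⊆ V, S.card = k ∧ (∀ e ⊆ S, e.card ≤ d → e ∈ E) ∧
        ∑ e ∈ E.filter (fun e => e ⊆ S), w e = t) ↔
      ∃ S ⊆ V, S.card = k ∧
        ∑ e ∈ S.powerset.filter (fun e => e.card ≤ d),
          (if e ∈ E then w e else (binomLe k d : ℤ) * M + 1) = t := by
  have ht : |t| ≤ M := by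
    rw [hM]
    exact Finset.le_max' _ _ (Finset.mem_insert_self _ _)
  have hw : ∀ e ∈ E, |w e| ≤ M := fun e he => by
    rw [hM]
    exact Finset.le_max' _ _
      (Finset.mem_insert_of_mem (Finset.mem_image_of_mem (fun e => |w e|) he))
  have hM0 : 0 ≤ M := (abs_nonneg t).trans ht
  have hsum : ∀ S : Finset α, (∀ e ⊆ S, e.card ≤ d → e ∈ E) →
      ∑ e ∈ S.powerset.filter (fun e => e.card ≤ d),
        (if e ∈ E then w e else (binomLe k d : ℤ) * M + 1) =
      ∑ e ∈ E.filter (fun e => e ⊆ S), w e := by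
    intro S hS
    have hSE : S.powerset.filter (fun e => e.card ≤ d) = E.filter (fun e => e ⊆ S) := by
      ext e
      simp only [Finset.mem_filter, Finset.mem_powerset]
      exact ⟨fun h => ⟨hS e h.1 h.2, h.1⟩, fun h => ⟨h.2, (hE e h.1).2⟩⟩
    rw [hSE]
    exact Finset.sum_congr rfl fun e he => if_pos (Finset.mem_filter.mp he).1
  constructor
  · rintro ⟨S, hSV, hSk, hS, hSt⟩
    exact ⟨S, hSV, hSk, (hsum S hS).trans hSt⟩
  · rintro ⟨S, hSV, hSk, hSt⟩
    have hS : ∀ e ⊆ S, e.card ≤ d → e ∈ E := by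
      intro e heS hed
      by_contra he
      have hlt := lt_sum_of_large_term (S.powerset.filter (fun e => e.card ≤ d))
        (fun e => if e ∈ E then w e else (binomLe k d : ℤ) * M + 1) M
        (fun i _ => by
          split_ifs with hi
          · exact (abs_le.mp (hw i hi)).1
          · have : 0 ≤ (binomLe k d : ℤ) * M := by positivity
            linarith)
        (Finset.mem_filter.mpr ⟨Finset.mem_powerset.mpr heS, hed⟩)
        (by rw [card_powerset_filter_card_le, hSk, if_neg he]; linarith)
      rw [hSt] at hlt
      exact absurd ((le_abs_self t).trans ht) hlt.not_ge
    exact ⟨S, hSV, hSk, hS, (hsum S hS).symm.trans hSt⟩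
end

section
/- Let d, k ∈ ℕ with 2 ≤ d ≤ k, and let G be a d-hypergraph with edge-weight function w : E(G) → ℤ and target t ∈ ℤ. Define the d-hypergraph G' with V(G') = {1,…,k} × V(G) whose edge set consists of all sets f = {(a_1,v_1),…,(a_{d'},v_{d'})} where 0 ≤ d' ≤ d, the colors a_1,…,a_{d'} ∈ {1,…,k} are pairwise distinct, and {v_1,…,v_{d'}} ∈ E(G) is an edge of size exactly d'; set w'(f) = w({v_1,…,v_{d'}}) (this is well defined). Then G' is k-partite with parts {i} × V(G), and G has a k-clique of weight t with respect to w if and only if G' has a k-clique of weight t with respect to w'. -/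
/-- The edge set of the `k`-partite lift `G'` of a hypergraph `G = (V, E)`:
vertices are pairs (color, vertex), and the edges are all sets
`f = {(a_1,v_1), …, (a_{d'},v_{d'})}` with pairwise distinct colors `a_s` and
pairwise distinct vertices `v_s` such that `{v_1, …, v_{d'}} ∈ E`. -/
def liftEdges {α : Type*} [DecidableEq α] (k : ℕ) (V : Finset α)
    (E : Finset (Finset α)) : Finset (Finset (Fin k × α)) :=
  ((Finset.univ ×ˢ V).powerset).filter
    (fun f => (∀ p ∈ f, ∀ q ∈ f, Prod.fst p = Prod.fst q → p = q) ∧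
      (f.image Prod.snd).card = f.card ∧ f.image Prod.snd ∈ E)

theorem mem_liftEdges_iff_of_subset {α : Type*} [DecidableEq α] {k : ℕ} {V : Finset α}
    {E : Finset (Finset α)} {S f : Finset (Fin k × α)} (hS : S ⊆ Finset.univ ×ˢ V)
    (hfst : Set.InjOn Prod.fst (S : Set (Fin k × α)))
    (hsnd : Set.InjOn Prod.snd (S : Set (Fin k × α))) (hf : f ⊆ S) :
    f ∈ liftEdges k V E ↔ f.image Prod.snd ∈ E := by
  simp only [liftEdges, Finset.mem_filter, Finset.mem_powerset]
  refine ⟨fun h => h.2.2.2, fun h => ⟨hf.trans hS, fun p hp q hq hpq =>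
    hfst (hf hp) (hf hq) hpq, ?_, h⟩⟩
  exact Finset.card_image_of_injOn (hsnd.mono (Finset.coe_subset.2 hf))

theorem exists_subset_image_snd_eq {α β : Type*} [DecidableEq α]
    {S : Finset (β × α)} (hsnd : Set.InjOn Prod.snd (S : Set (β × α)))
    {e : Finset α} (he : e ⊆ S.image Prod.snd) :
    ∃ f ⊆ S, f.image Prod.snd = e ∧ f.card = e.card := by
  obtain ⟨f, hf, rfl⟩ := Finset.subset_image_iff.1 he
  exact ⟨f, Finset.coe_subset.1 hf, rfl,
    (Finset.card_image_of_injOn (hsnd.mono hf)).symm⟩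

theorem sum_liftEdges_subset {α : Type*} [DecidableEq α] {k : ℕ} {V : Finset α}
    {E : Finset (Finset α)} {S : Finset (Fin k × α)} (hS : S ⊆ Finset.univ ×ˢ V)
    (hfst : Set.InjOn Prod.fst (S : Set (Fin k × α)))
    (hsnd : Set.InjOn Prod.snd (S : Set (Fin k × α))) (w : Finset α → ℤ) :
    ∑ f ∈ (liftEdges k V E).filter (fun f => f ⊆ S), w (f.image Prod.snd) =
      ∑ e ∈ E.filter (fun e => e ⊆ S.image Prod.snd), w e := by
  refine Finset.sum_nbij (fun f => f.image Prod.snd) ?_ ?_ ?_ (fun _ _ => rfl)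
  · intro f hf
    rw [Finset.mem_filter] at hf ⊢
    exact ⟨(mem_liftEdges_iff_of_subset hS hfst hsnd hf.2).1 hf.1,
      Finset.image_subset_image hf.2⟩
  · intro f hf g hg hfg
    have hf' := (Finset.mem_filter.1 hf).2
    have hg' := (Finset.mem_filter.1 hg).2
    have h : Prod.snd '' (f : Set (Fin k × α)) = Prod.snd '' (g : Set (Fin k × α)) := by
      simpa only [Finset.coe_image] using congrArg (fun s : Finset α => (s : Set α)) hfg
    exact Finset.coe_injective ((hsnd.image_eq_image_iff (Finset.coe_subset.2 hf')
      (Finset.coe_subset.2 hg')).1 h)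
  · intro e he
    obtain ⟨heE, heS⟩ := Finset.mem_filter.1 he
    obtain ⟨f, hf, rfl, -⟩ := exists_subset_image_snd_eq hsnd heS
    exact ⟨f, Finset.mem_filter.2
      ⟨(mem_liftEdges_iff_of_subset hS hfst hsnd hf).2 heE, hf⟩, rfl⟩

theorem exists_colored_lift {α : Type*} [DecidableEq α] {k : ℕ} {V S : Finset α}
    (hSV : S ⊆ V) (hS : S.card = k) :
    ∃ S' : Finset (Fin k × α), S' ⊆ Finset.univ ×ˢ V ∧ S'.card = k ∧
      Set.InjOn Prod.fst (S' : Set (Fin k × α)) ∧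
      Set.InjOn Prod.snd (S' : Set (Fin k × α)) ∧ S'.image Prod.snd = S := by
  let g := S.equivFinOfCardEq hS
  have hg : Function.Injective fun x : S => (g x, (x : α)) := fun x y h =>
    Subtype.ext (congrArg Prod.snd h)
  refine ⟨Finset.univ.image fun x : S => (g x, (x : α)), ?_, ?_, ?_, ?_, ?_⟩
  · intro p hp
    obtain ⟨x, -, rfl⟩ := Finset.mem_image.1 hp
    simpa using hSV x.2
  · rw [Finset.card_image_of_injective _ hg]
    simpa using hS
  · intro p hp q hq h
    obtain ⟨x, -, rfl⟩ := Finset.mem_image.1 hp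
    obtain ⟨y, -, rfl⟩ := Finset.mem_image.1 hq
    rw [g.injective h]
  · intro p hp q hq h
    obtain ⟨x, -, rfl⟩ := Finset.mem_image.1 hp
    obtain ⟨y, -, rfl⟩ := Finset.mem_image.1 hq
    rw [Subtype.ext h]
  · ext a
    simp

/-- "Make `k`-partite": the lift `G'` with `V(G') = {1,…,k} × V(G)`,
edge weights `w'(f) = w(image of f)`, is `k`-partite with parts `{i} × V(G)`,
and `G` has a `k`-clique of weight `t` w.r.t. `w` iff `G'` has a `k`-clique
of weight `t` w.r.t. `w'`. -/
theorem stmt5 {α : Type*} [DecidableEq α] (d k : ℕ) (hd : 2 ≤ d) (hdk : d ≤ k)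
    (V : Finset α) (E : Finset (Finset α))
    (hE : ∀ e ∈ E, e ⊆ V ∧ e.card ≤ d)
    (w : Finset α → ℤ) (t : ℤ) :
    (∀ f ∈ liftEdges k V E, f ⊆ Finset.univ ×ˢ V ∧ f.card ≤ d ∧
        ∀ i : Fin k, (f.filter (fun p => p.1 = i)).card ≤ 1) ∧
    ((∃ S ⊆ V, S.card = k ∧ (∀ e ⊆ S, e.card ≤ d → e ∈ E) ∧
        ∑ e ∈ E.filter (fun e => e ⊆ S), w e = t) ↔
      ∃ S' ⊆ Finset.univ ×ˢ V, S'.card = k ∧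
        (∀ f ⊆ S', f.card ≤ d → f ∈ liftEdges k V E) ∧
        ∑ f ∈ (liftEdges k V E).filter (fun f => f ⊆ S'),
          w (f.image Prod.snd) = t) := by
  constructor
  · intro f hf
    simp only [liftEdges, Finset.mem_filter, Finset.mem_powerset] at hf
    obtain ⟨hfV, hinj, hcard, hfE⟩ := hf
    refine ⟨hfV, hcard ▸ (hE _ hfE).2, fun i => Finset.card_le_one.2 fun p hp q hq => ?_⟩
    rw [Finset.mem_filter] at hp hq
    exact hinj p hp.1 q hq.1 (hp.2.trans hq.2.symm)
  constructor
  · rintro ⟨S, hSV, hSk, hclique, hsum⟩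
    obtain ⟨S', hS'V, hS'k, hfst, hsnd, rfl⟩ := exists_colored_lift hSV hSk
    refine ⟨S', hS'V, hS'k, fun f hf hfd => ?_, ?_⟩
    · exact (mem_liftEdges_iff_of_subset hS'V hfst hsnd hf).2
        (hclique _ (Finset.image_subset_image hf) (Finset.card_image_le.trans hfd))
    · rw [sum_liftEdges_subset hS'V hfst hsnd, hsum]
  · rintro ⟨S', hS'V, hS'k, hclique, hsum⟩
    have hpair : ∀ p ∈ S', ∀ q ∈ S', {p, q} ∈ liftEdges k V E := fun p hp q hq =>
      hclique _ (Finset.insert_subset hp (Finset.singleton_subset_iff.2 hq))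
        (Finset.card_le_two.trans hd)
    simp only [liftEdges, Finset.mem_filter] at hpair
    have hfst : Set.InjOn Prod.fst (S' : Set (Fin k × α)) := fun p hp q hq h =>
      (hpair p hp q hq).2.1 p (by simp) q (by simp) h
    have hsnd : Set.InjOn Prod.snd (S' : Set (Fin k × α)) := fun p hp q hq h =>
      Finset.card_image_iff.1 (hpair p hp q hq).2.2.1 (by simp) (by simp) h
    refine ⟨S'.image Prod.snd, ?_, ?_, fun e he hed => ?_, ?_⟩
    · exact Finset.image_subset_iff.2 fun p hp => (Finset.mem_product.1 (hS'V hp)).2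
    · rw [Finset.card_image_of_injOn hsnd, hS'k]
    · obtain ⟨f, hf, rfl, hcard⟩ := exists_subset_image_snd_eq hsnd he
      exact (mem_liftEdges_iff_of_subset hS'V hfst hsnd hf).1 (hclique f hf (hcard.trans_le hed))
    · rw [← sum_liftEdges_subset hS'V hfst hsnd, hsum]
end

section
/- Let d, k ∈ ℕ with 2 ≤ d ≤ k, and let G be a complete k-partite d-hypergraph with parts V_1,…,V_k, i.e., E(G) consists of all sets e ⊆ V(G) with |e| ≤ d that intersect each part in at most one vertex. Let w : E(G) → ℤ be an edge-weight function and t ∈ ℤ. For an edge e ∈ E(G) let χ(e) = {i ∈ {1,…,k} : e ∩ V_i ≠ ∅}. Then G has a k-clique of weight t if and only if there exists a function a assigning an integer a(C) to every set C ⊆ {1,…,k} with |C| ≤ d such that Σ_{C ⊆ {1,…,k}, |C| ≤ d} a(C) = t and the d-hypergraph G_a with V(G_a) = V(G) and E(G_a) = {e ∈ E(G) : w(e) = a(χ(e))} contains a k-clique. -/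
/-- A set of `k` vertices covered by `k` disjoint parts, every two-element subset of which meets
each part at most once, picks exactly one vertex from each part. -/
theorem exists_transversal_of_card_eq {α : Type*} [DecidableEq α] {k : ℕ}
    {P : Fin k → Finset α} (hdisj : ∀ i j, i ≠ j → Disjoint (P i) (P j))
    {S : Finset α} (hS : S ⊆ Finset.univ.biUnion P) (hcard : S.card = k)
    (hpair : ∀ e ⊆ S, e.card ≤ 2 → ∀ i, (e ∩ P i).card ≤ 1) :
    ∃ f : Fin k → α, (∀ i, f i ∈ P i) ∧ S = Finset.univ.image f := by
  have hle : ∀ i, (S ∩ P i).card ≤ 1 := by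
    intro i
    rw [Finset.card_le_one]
    intro x hx y hy
    rw [Finset.mem_inter] at hx hy
    have h := hpair {x, y} (by
      intro z hz
      rw [Finset.mem_insert, Finset.mem_singleton] at hz
      rcases hz with rfl | rfl
      exacts [hx.1, hy.1]) Finset.card_le_two i
    rw [Finset.card_le_one] at h
    exact h x (by simp [hx.2]) y (by simp [hy.2])
  have hsum : ∑ i, (S ∩ P i).card = ∑ _i : Fin k, 1 := by
    rw [← Finset.card_biUnion, ← Finset.inter_biUnion, Finset.inter_eq_left.mpr hS, hcard]
    · simp
    · intro i _ j _ hij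
      exact (hdisj i j hij).mono Finset.inter_subset_right Finset.inter_subset_right
  have hone := (Finset.sum_eq_sum_iff_of_le fun i _ => hle i).mp hsum
  have hex : ∀ i, ∃ x, S ∩ P i = {x} := fun i =>
    Finset.card_eq_one.mp (hone i (Finset.mem_univ i))
  choose f hf using hex
  have hmem : ∀ i, f i ∈ S ∩ P i := fun i => by simp [hf i]
  refine ⟨f, fun i => (Finset.mem_inter.mp (hmem i)).2, ?_⟩
  ext x
  simp only [Finset.mem_image, Finset.mem_univ, true_and]
  constructor
  · intro hx
    obtain ⟨i, -, hi⟩ := Finset.mem_biUnion.mp (hS hx)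
    have hxi : x ∈ S ∩ P i := Finset.mem_inter.mpr ⟨hx, hi⟩
    rw [hf i, Finset.mem_singleton] at hxi
    exact ⟨i, hxi.symm⟩
  · rintro ⟨i, rfl⟩
    exact (Finset.mem_inter.mp (hmem i)).1

/-- The parts met by the image of `C` under a transversal are those indexed by `C`. -/
theorem filter_image_inter_nonempty {α : Type*} [DecidableEq α] {k : ℕ}
    {P : Fin k → Finset α} (hdisj : ∀ i j, i ≠ j → Disjoint (P i) (P j))
    {f : Fin k → α} (hf : ∀ i, f i ∈ P i) (C : Finset (Fin k)) :
    Finset.univ.filter (fun i : Fin k => (C.image f ∩ P i).Nonempty) = C := by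
  ext i
  simp only [Finset.mem_filter, Finset.mem_univ, true_and]
  constructor
  · rintro ⟨x, hx⟩
    obtain ⟨hxC, hxi⟩ := Finset.mem_inter.mp hx
    obtain ⟨j, hj, rfl⟩ := Finset.mem_image.mp hxC
    by_contra hi
    exact Finset.disjoint_left.mp (hdisj j i fun h => hi (h ▸ hj)) (hf j) hxi
  · exact fun hi => ⟨f i, Finset.mem_inter.mpr ⟨Finset.mem_image_of_mem f hi, hf i⟩⟩

/-- The choice function of a transversal of disjoint parts is injective. -/
theorem transversal_injective {α : Type*} {k : ℕ}
    {P : Fin k → Finset α} (hdisj : ∀ i j, i ≠ j → Disjoint (P i) (P j))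
    {f : Fin k → α} (hf : ∀ i, f i ∈ P i) : Function.Injective f := by
  intro i j hij
  by_contra hne
  exact Finset.disjoint_left.mp (hdisj i j hne) (hf i) (hij ▸ hf j)

/-- The sum over the edges inside the image of an injective `f` equals the sum over
index sets of size at most `d`, when all small subsets of the image are edges. -/
theorem sum_filter_subset_image {α : Type*} [DecidableEq α] {d k : ℕ}
    {f : Fin k → α} (hf : Function.Injective f) {E : Finset (Finset α)}
    (hE : ∀ e ∈ E, e.card ≤ d)
    (hclique : ∀ e ⊆ Finset.univ.image f, e.card ≤ d → e ∈ E) (w : Finset α → ℤ) :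
    ∑ e ∈ E.filter (fun e => e ⊆ Finset.univ.image f), w e =
      ∑ C ∈ (Finset.univ : Finset (Fin k)).powerset.filter (fun C => C.card ≤ d),
        w (C.image f) := by
  symm
  refine Finset.sum_bij (fun C _ => C.image f) ?_ ?_ ?_ ?_
  · intro C hC
    have hsub : C.image f ⊆ Finset.univ.image f := Finset.image_subset_image (Finset.subset_univ C)
    exact Finset.mem_filter.mpr
      ⟨hclique _ hsub (Finset.card_image_le.trans (Finset.mem_filter.mp hC).2), hsub⟩
  · exact fun C _ D _ h => Finset.image_injective hf h
  · intro e he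
    obtain ⟨heE, hsub⟩ := Finset.mem_filter.mp he
    obtain ⟨C, -, rfl⟩ := Finset.subset_image_iff.mp hsub
    refine ⟨C, ?_, rfl⟩
    have hC := hE _ heE
    rw [Finset.card_image_of_injective C hf] at hC
    simpa using hC
  · exact fun _ _ => rfl

/-- Splitting weights by color type: let `G` be the complete `k`-partite
`d`-hypergraph with parts `P i` (so `E(G)` consists of all `e ⊆ V(G)` with
`|e| ≤ d` meeting each part in at most one vertex), with weights `w` and target
`t`. For an edge `e` let `χ(e) = {i : e ∩ P i ≠ ∅}`. Then `G` has a `k`-clique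
of weight `t` iff there is `a : {C ⊆ {1,…,k} : |C| ≤ d} → ℤ` with
`Σ_C a(C) = t` such that the subhypergraph `G_a` keeping only the edges with
`w(e) = a(χ(e))` contains a `k`-clique. -/
theorem stmt9 {α : Type*} [DecidableEq α] (d k : ℕ) (hd : 2 ≤ d) (hdk : d ≤ k)
    (P : Fin k → Finset α)
    (hdisj : ∀ i j, i ≠ j → Disjoint (P i) (P j))
    (w : Finset α → ℤ) (t : ℤ) :
    (∃ S ⊆ Finset.univ.biUnion P, S.card = k ∧
        (∀ e ⊆ S, e.card ≤ d →
          e ∈ (Finset.univ.biUnion P).powerset.filter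
            (fun e => e.card ≤ d ∧ ∀ i : Fin k, (e ∩ P i).card ≤ 1)) ∧
        ∑ e ∈ ((Finset.univ.biUnion P).powerset.filter
            (fun e => e.card ≤ d ∧ ∀ i : Fin k, (e ∩ P i).card ≤ 1)).filter
            (fun e => e ⊆ S), w e = t) ↔
      ∃ a : Finset (Fin k) → ℤ,
        (∑ C ∈ (Finset.univ : Finset (Fin k)).powerset.filter
            (fun C => C.card ≤ d), a C = t) ∧
        ∃ S ⊆ Finset.univ.biUnion P, S.card = k ∧
          ∀ e ⊆ S, e.card ≤ d →
            e ∈ ((Finset.univ.biUnion P).powerset.filter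
                (fun e => e.card ≤ d ∧ ∀ i : Fin k, (e ∩ P i).card ≤ 1)).filter
              (fun e => w e = a (Finset.univ.filter
                (fun i : Fin k => (e ∩ P i).Nonempty))) := by
  constructor
  · rintro ⟨S, hS, hcard, hclique, hsum⟩
    obtain ⟨f, hf, rfl⟩ := exists_transversal_of_card_eq hdisj hS hcard
      fun e he hle => (Finset.mem_filter.mp (hclique e he (hle.trans hd))).2.2
    refine ⟨fun C => w (C.image f), ?_, Finset.univ.image f, hS, hcard, ?_⟩
    · rw [← hsum]
      exact (sum_filter_subset_image (transversal_injective hdisj hf)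
        (fun e he => (Finset.mem_filter.mp he).2.1) hclique w).symm
    · intro e he hle
      refine Finset.mem_filter.mpr ⟨hclique e he hle, ?_⟩
      obtain ⟨C, -, rfl⟩ := Finset.subset_image_iff.mp he
      rw [filter_image_inter_nonempty hdisj hf]
  · rintro ⟨a, hsum, S, hS, hcard, hclique⟩
    have hedge := fun e he hle => (Finset.mem_filter.mp (hclique e he hle)).1
    obtain ⟨f, hf, rfl⟩ := exists_transversal_of_card_eq hdisj hS hcard
      fun e he hle => (Finset.mem_filter.mp (hedge e he (hle.trans hd))).2.2
    refine ⟨Finset.univ.image f, hS, hcard, hedge, ?_⟩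
    rw [sum_filter_subset_image (transversal_injective hdisj hf)
      (fun e he => (Finset.mem_filter.mp he).2.1) hedge w, ← hsum]
    refine Finset.sum_congr rfl fun C hC => ?_
    have hw := (Finset.mem_filter.mp (hclique (C.image f)
      (Finset.image_subset_image (Finset.subset_univ C))
      (Finset.card_image_le.trans (Finset.mem_filter.mp hC).2))).2
    rwa [filter_image_inter_nonempty hdisj hf] at hw
end

section
/- Let d, k ∈ ℕ with 1 ≤ d ≤ k, and let G be a k-partite d-hypergraph with parts V_1,…,V_k. Let Ē = {h ⊆ V(G) : |h| ≤ d and |h ∩ V_i| ≤ 1 for all i} \ E(G) be the set of non-edges. For i ∈ {1,…,k} and v ∈ V_i define x_v : Ē → {0,1} by x_v(h) = 0 if h ∩ V_i ≠ ∅ and v ∉ h, and x_v(h) = 1 otherwise. Then for all v_1 ∈ V_1, …, v_k ∈ V_k: the set {v_1,…,v_k} is a k-clique of G if and only if Σ_{h ∈ Ē} Π_{i=1}^{k} x_{v_i}(h) = 0, where the sum and product are over the integers. -/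
/-- Reduction from `k`-partite hypergraph `k`-Clique to `k`-OV: with
`Ē` the set of non-edges and `x_v(h) = 0` iff `h` meets the part of `v` but
`v ∉ h`, vertices `v_1 ∈ V_1, …, v_k ∈ V_k` form a `k`-clique iff
`Σ_{h ∈ Ē} Π_i x_{v_i}(h) = 0` (over the integers). -/
theorem stmt10 {α : Type*} [DecidableEq α] (d k : ℕ) (hd : 1 ≤ d) (hdk : d ≤ k)
    (P : Fin k → Finset α)
    (hdisj : ∀ i j, i ≠ j → Disjoint (P i) (P j))
    (E : Finset (Finset α))
    (hE : ∀ e ∈ E, e ⊆ Finset.univ.biUnion P ∧ e.card ≤ d ∧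
      ∀ i : Fin k, (e ∩ P i).card ≤ 1)
    (v : Fin k → α) (hv : ∀ i, v i ∈ P i) :
    (Finset.univ.image v ⊆ Finset.univ.biUnion P ∧
      (Finset.univ.image v).card = k ∧
      (∀ e ⊆ Finset.univ.image v, e.card ≤ d → e ∈ E)) ↔
      ∑ h ∈ ((Finset.univ.biUnion P).powerset.filter
          (fun h => h.card ≤ d ∧ ∀ i : Fin k, (h ∩ P i).card ≤ 1)) \ E,
        ∏ i : Fin k,
          (if (h ∩ P i).Nonempty ∧ v i ∉ h then (0 : ℤ) else 1) = 0 := by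
  have hpart : ∀ i j, v j ∈ P i → j = i := by
    intro i j h
    by_contra hne
    exact Finset.disjoint_left.mp (hdisj j i hne) (hv j) h
  have hinj : Function.Injective v := fun i j h => hpart j i (h ▸ hv j)
  have hsub : Finset.univ.image v ⊆ Finset.univ.biUnion P := by
    intro x hx
    obtain ⟨i, -, rfl⟩ := Finset.mem_image.mp hx
    exact Finset.mem_biUnion.mpr ⟨i, Finset.mem_univ i, hv i⟩
  have hcard : (Finset.univ.image v).card = k := by
    rw [Finset.card_image_of_injective _ hinj, Finset.card_univ, Fintype.card_fin]
  rw [Finset.sum_eq_zero_iff_of_nonneg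
    (fun h _ => Finset.prod_nonneg fun i _ => by split_ifs <;> norm_num)]
  constructor
  · rintro ⟨-, -, hclique⟩ h hh
    simp only [Finset.mem_sdiff, Finset.mem_filter, Finset.mem_powerset] at hh
    obtain ⟨⟨hV, hd', hone⟩, hnE⟩ := hh
    rw [Finset.prod_eq_zero_iff]
    by_contra hcon
    refine hnE (hclique h (fun x hx => ?_) hd')
    obtain ⟨i, -, hxi⟩ := Finset.mem_biUnion.mp (hV hx)
    have hxP : x ∈ h ∩ P i := Finset.mem_inter.mpr ⟨hx, hxi⟩
    have hvh : v i ∈ h := by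
      by_contra hvi
      exact hcon ⟨i, Finset.mem_univ i, if_pos ⟨⟨x, hxP⟩, hvi⟩⟩
    have hxv : v i = x :=
      Finset.card_le_one.mp (hone i) _ (Finset.mem_inter.mpr ⟨hvh, hv i⟩) _ hxP
    exact Finset.mem_image.mpr ⟨i, Finset.mem_univ i, hxv⟩
  · intro hzero
    refine ⟨hsub, hcard, fun e he hed => ?_⟩
    have hmeet : ∀ i, ∀ x ∈ e ∩ P i, x = v i := by
      intro i x hx
      obtain ⟨hxe, hxi⟩ := Finset.mem_inter.mp hx
      obtain ⟨j, -, rfl⟩ := Finset.mem_image.mp (he hxe)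
      rw [hpart i j hxi]
    by_contra heE
    have hprod := hzero e (by
      simp only [Finset.mem_sdiff, Finset.mem_filter, Finset.mem_powerset]
      exact ⟨⟨he.trans hsub, hed, fun i => Finset.card_le_one.mpr fun a ha b hb =>
        (hmeet i a ha).trans (hmeet i b hb).symm⟩, heE⟩)
    obtain ⟨i, -, hi⟩ := Finset.prod_eq_zero_iff.mp hprod
    split_ifs at hi with hc
    · obtain ⟨⟨x, hx⟩, hvi⟩ := hc
      exact hvi (hmeet i x hx ▸ (Finset.mem_inter.mp hx).1)
    · exact one_ne_zero hi
end

section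
/- Let T be a tree with m vertices in which every vertex has degree at most 3, and let ℓ ∈ ℕ with 1 ≤ ℓ ≤ m. Then there exists a set A ⊆ V(T) with |A| ≤ 6m/ℓ such that every connected component C of T − A has at most ℓ vertices and at most three vertices of A are adjacent in T to vertices of C. -/
/-- Bottom-up greedy clustering of a finite forest given by a parent function `p`: the vertices
outside the cut set `A` are grouped by `rep` into parent-connected clusters of `w`-weight at most
`ℓ`, each with at most one cut child and at most one cut parent. The weight `k` counts cut children
lying outside `S`. -/
theorem exists_forest_clustering {V : Type*} [DecidableEq V] (p : V → V) (d : V → ℕ)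
    (hd : ∀ v, p v = v ∨ d (p v) < d v) (ℓ : ℕ) (S : Finset V) (hS : ∀ v ∈ S, p v ∈ S)
    (w k : V → ℕ) :
    ∃ (A : Finset V) (rep : V → V), A ⊆ S ∧ ℓ * A.card ≤ ∑ v ∈ S, (2 * w v + ℓ * k v) ∧
      (∀ v ∈ S, v ∉ A → rep v ∈ S) ∧
      (∀ v ∈ S, v ∉ A → p v ∉ A → rep v = rep (p v)) ∧
      (∀ x ∈ S, x ∉ A → ∀ y ∈ S, y ∉ A → rep x = rep y → p x ∈ A → p y ∈ A → p x = p y) ∧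
      (∀ t, ∑ v ∈ S with v ∉ A ∧ rep v = t, w v ≤ ℓ) ∧
      (∀ t, ∑ v ∈ S with v ∉ A ∧ rep v = t, k v +
        {a ∈ A | p a ∉ A ∧ rep (p a) = t}.card ≤ 1) := by
  induction hn : S.card generalizing S w k with
  | zero =>
    obtain rfl := Finset.card_eq_zero.mp hn
    exact ⟨∅, id, by simp⟩
  | succ n ih =>
    obtain ⟨v, hv, hmax⟩ := S.exists_max_image d (Finset.card_pos.mp (by omega))
    obtain ⟨S, hvS, rfl⟩ : ∃ S', v ∉ S' ∧ S = insert v S' :=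
      ⟨S.erase v, Finset.notMem_erase v S, (Finset.insert_erase hv).symm⟩
    have hpne : ∀ x ∈ S, p x ≠ v := by
      rintro x hx rfl
      have h1 := hmax x (Finset.mem_insert_of_mem hx)
      rcases hd x with h | h
      · exact hvS (h.symm ▸ hx)
      · omega
    have hS' : ∀ x ∈ S, p x ∈ S := fun x hx =>
      Finset.mem_of_mem_insert_of_ne (hS x (Finset.mem_insert_of_mem hx)) (hpne x hx)
    have hcard : S.card = n := by rw [Finset.card_insert_of_notMem hvS] at hn; omega
    rw [Finset.sum_insert hvS]
    by_cases hcut : ℓ < w v ∨ 2 ≤ k v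
    · obtain ⟨A, rep, hA, hbound, hrep, hpar, htop, hw, hk⟩ :=
        ih S hS' w (fun x => k x + if p v = x then 1 else 0) hcard
      clear ih hn hcard hmax hd hv
      have hvA : v ∉ A := fun h => hvS (hA h)
      have hfilter (t : V) : {x ∈ insert v S | x ∉ insert v A ∧ rep x = t} =
          {x ∈ S | x ∉ A ∧ rep x = t} := by
        ext x
        by_cases hx : x = v <;> simp [hx, hvS]
      refine ⟨insert v A, rep, Finset.insert_subset_insert v hA, ?_, ?_, ?_, ?_, ?_, ?_⟩
      · rw [Finset.card_insert_of_notMem hvA]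
        simp only [mul_add, Finset.sum_add_distrib, mul_ite, mul_one, mul_zero,
          Finset.sum_ite_eq] at hbound ⊢
        have h2 : 2 * ℓ ≤ 2 * w v + ℓ * k v := by
          rcases hcut with h | h <;> nlinarith
        split_ifs at hbound <;> omega
      · simp only [Finset.mem_insert]
        grind only
      · simp only [Finset.mem_insert]
        grind only
      · simp only [Finset.mem_insert]
        grind only
      · intro t
        rw [hfilter]
        exact hw t
      · intro t
        rw [hfilter]
        have hkt := hk t
        simp only [Finset.sum_add_distrib, Finset.sum_ite_eq, Finset.mem_filter] at hkt
        have hsub : {a ∈ insert v A | p a ∉ insert v A ∧ rep (p a) = t} ⊆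
            insert v {a ∈ A | p a ∉ A ∧ rep (p a) = t} := by
          intro a
          simp only [Finset.mem_filter, Finset.mem_insert]
          tauto
        split_ifs at hkt with hu
        · have := Finset.card_le_card hsub
          have := Finset.card_insert_le v {a ∈ A | p a ∉ A ∧ rep (p a) = t}
          omega
        · have hv_notMem : v ∉ {a ∈ insert v A | p a ∉ insert v A ∧ rep (p a) = t} := by
            have := hS v (Finset.mem_insert_self v S)
            simp only [Finset.mem_filter, Finset.mem_insert] at this ⊢
            tauto
          have := Finset.card_le_card ((Finset.subset_insert_iff_of_notMem hv_notMem).mp hsub)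
          omega
    · push Not at hcut
      obtain ⟨A, rep, hA, hbound, hrep, hpar, htop, hw, hk⟩ :=
        ih S hS' (fun x => w x + if p v = x then w v else 0)
          (fun x => k x + if p v = x then k v else 0) hcard
      clear ih hn hcard hmax hd hv
      have hvA : v ∉ A := fun h => hvS (hA h)
      simp only [Finset.sum_add_distrib, Finset.sum_ite_eq, Finset.mem_filter] at hw hk
      set r := if p v ∈ S ∧ p v ∉ A then rep (p v) else v with hr
      have hrep_v : Function.update rep v r v = r := Function.update_self ..
      have hrep_ne : ∀ x ∈ S, Function.update rep v r x = rep x := fun x hx =>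
        Function.update_of_ne (fun (h : x = v) => hvS (h ▸ hx)) ..
      have hsum (f : V → ℕ) (t : V) :
          ∑ x ∈ insert v S with x ∉ A ∧ Function.update rep v r x = t, f x =
            ∑ x ∈ S with x ∉ A ∧ rep x = t, f x + if r = t then f v else 0 := by
        rw [Finset.sum_filter, Finset.sum_insert hvS, Finset.sum_filter, add_comm, hrep_v]
        simp only [hvA, not_false_eq_true, true_and]
        congr 1
        exact Finset.sum_congr rfl fun x hx => by rw [hrep_ne x hx]
      have hcut_children (t : V) : {a ∈ A | p a ∉ A ∧ Function.update rep v r (p a) = t} =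
          {a ∈ A | p a ∉ A ∧ rep (p a) = t} :=
        Finset.filter_congr fun a ha => by rw [hrep_ne _ (hS' a (hA ha))]
      have hfresh : {x ∈ S | x ∉ A ∧ rep x = v} = ∅ :=
        Finset.filter_eq_empty_iff.mpr fun x hx h => hvS (h.2 ▸ hrep x hx h.1)
      have hfresh' : {a ∈ A | p a ∉ A ∧ rep (p a) = v} = ∅ :=
        Finset.filter_eq_empty_iff.mpr fun a ha h => hvS (h.2 ▸ hrep _ (hS' a (hA ha)) h.1)
      refine ⟨A, Function.update rep v r, hA.trans (Finset.subset_insert v S), ?_, ?_, ?_, ?_,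
        ?_, ?_⟩
      · simp only [mul_add, Finset.sum_add_distrib, mul_ite, mul_zero,
          Finset.sum_ite_eq] at hbound ⊢
        split_ifs at hbound <;> omega
      · simp only [Finset.mem_insert]
        grind only
      · have := hS v (Finset.mem_insert_self v S)
        simp only [Finset.mem_insert] at this ⊢
        grind only
      · have := hS v (Finset.mem_insert_self v S)
        simp only [Finset.mem_insert] at this ⊢
        have hApv : p v ∈ A → r = v := by grind only
        grind only
      · intro t
        rw [hsum]
        have hwt := hw t
        by_cases hu : p v ∈ S ∧ p v ∉ A
        · simp only [hr, if_pos hu]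
          simpa only [hu, true_and, not_false_eq_true] using hwt
        · rw [hr, if_neg hu]
          split_ifs with hvt
          · subst hvt
            simpa [hfresh] using hcut.1
          · omega
      · intro t
        rw [hsum, hcut_children]
        have hkt := hk t
        by_cases hu : p v ∈ S ∧ p v ∉ A
        · simp only [hr, if_pos hu]
          simpa only [hu, true_and, not_false_eq_true] using hkt
        · rw [hr, if_neg hu]
          split_ifs with hvt
          · subst hvt
            simp only [hfresh, hfresh', Finset.sum_empty, Finset.card_empty]
            omega
          · omega

/-- A tree admits a parent function, with the root as its own parent. -/
theorem SimpleGraph.IsTree.exists_parent {V : Type*} {T : SimpleGraph V} (hT : T.IsTree) :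
    ∃ (p : V → V) (d : V → ℕ), (∀ v, p v = v ∨ d (p v) < d v) ∧
      ∀ x y, T.Adj x y → p x = y ∨ p y = x := by
  have := hT.connected.nonempty
  inhabit V
  choose q hq hq' using (hT.existsUnique_path · default)
  refine ⟨fun v => (q v).snd, fun v => (q v).length, fun v => ?_, fun x y hxy => ?_⟩
  · by_cases hv : (q v).Nil
    · left
      have hlen := SimpleGraph.Walk.length_eq_zero_iff.mpr hv
      exact ((q v).getVert_of_length_le (by omega)).trans hv.eq.symm
    · have htail := hq' _ _ (hq v).tail
      have hlen := SimpleGraph.Walk.length_tail_add_one hv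
      rw [htail] at hlen
      right
      dsimp only
      omega
  · by_cases hy : y ∈ (q x).support
    · exact .inl (hT.isAcyclic.eq_snd_of_adj_start (hq x) hxy hy).symm
    · right
      dsimp only
      rw [← hq' y _ ((hq x).cons hy (h := hxy.symm)), SimpleGraph.Walk.snd_cons]

/-- Decomposition of trees of maximum degree 3 (Impagliazzo–Meka–Zuckerman):
if `T` is a tree on `m` vertices of maximum degree at most `3` and `1 ≤ ℓ ≤ m`,
then there is `A ⊆ V(T)` with `|A| ≤ 6m/ℓ` such that every connected component
`C` of `T − A` has at most `ℓ` vertices and at most three vertices of `A` are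
adjacent to vertices of `C`. -/
theorem stmt12 {V : Type*} [Fintype V] [DecidableEq V] (T : SimpleGraph V)
    [DecidableRel T.Adj] (hT : T.IsTree)
    (hdeg : ∀ v : V, T.degree v ≤ 3)
    (m ℓ : ℕ) (hm : Fintype.card V = m) (hℓ1 : 1 ≤ ℓ) (hℓm : ℓ ≤ m) :
    ∃ A : Finset V, ℓ * A.card ≤ 6 * m ∧
      ∀ c : (T.induce {v : V | v ∉ A}).ConnectedComponent,
        c.supp.ncard ≤ ℓ ∧
        {a : V | a ∈ A ∧ ∃ u ∈ c.supp, T.Adj a ↑u}.ncard ≤ 3 := by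
  obtain ⟨p, d, hd, hp⟩ := hT.exists_parent
  obtain ⟨A, rep, -, hbound, -, hpar, htop, hw, hk⟩ :=
    exists_forest_clustering p d hd ℓ Finset.univ (by simp) (fun _ => 1) (fun _ => 0)
  refine ⟨A, ?_, fun c => ?_⟩
  · simp [hm] at hbound
    omega
  have hconst : ∃ t, ∀ u ∈ c.supp, rep u = t := by
    induction c using SimpleGraph.ConnectedComponent.ind with | h v =>
    refine ⟨rep v, fun u hu => ?_⟩
    rw [SimpleGraph.ConnectedComponent.mem_supp_iff, SimpleGraph.ConnectedComponent.eq] at hu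
    obtain ⟨q⟩ := hu
    induction q with
    | nil => rfl
    | @cons a b _ hab _ ih =>
      rw [← ih]
      have ha : (a : V) ∉ A := a.2
      have hb : (b : V) ∉ A := b.2
      rcases hp a b hab with h | h
      · exact (hpar a (Finset.mem_univ _) ha (h ▸ hb)).trans (congrArg rep h)
      · exact ((hpar b (Finset.mem_univ _) hb (h ▸ ha)).trans (congrArg rep h)).symm
  obtain ⟨t, ht⟩ := hconst
  have hmem (u : {v : V | v ∉ A}) : (u : V) ∉ A := u.2
  constructor
  · have hsub : Subtype.val '' c.supp ⊆
        (({v | v ∉ A ∧ rep v = t} : Finset V) : Set V) := by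
      rintro _ ⟨u, hu, rfl⟩
      exact Finset.mem_coe.mpr (Finset.mem_filter.mpr ⟨Finset.mem_univ _, hmem u, ht u hu⟩)
    rw [← Set.ncard_image_of_injective _ Subtype.val_injective]
    refine (Set.ncard_le_ncard hsub).trans ?_
    rw [Set.ncard_coe_finset, Finset.card_eq_sum_ones]
    exact hw t
  · have hsub : {a : V | a ∈ A ∧ ∃ u ∈ c.supp, T.Adj a ↑u} ⊆
        (({a ∈ A | p a ∉ A ∧ rep (p a) = t} : Finset V) : Set V) ∪
          {a | a ∈ A ∧ ∃ u ∈ c.supp, p u = a} := by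
      rintro a ⟨ha, u, hu, hau⟩
      rcases hp _ _ hau with h | h
      · left
        rw [Finset.mem_coe, Finset.mem_filter, h]
        exact ⟨ha, hmem u, ht u hu⟩
      · exact .inr ⟨ha, u, hu, h⟩
    have hone : {a | a ∈ A ∧ ∃ u ∈ c.supp, p u = a}.ncard ≤ 1 := by
      rw [Set.ncard_le_one]
      rintro _ ⟨ha, u, hu, rfl⟩ _ ⟨hb, v, hv, rfl⟩
      exact htop u (Finset.mem_univ _) (hmem u) v (Finset.mem_univ _) (hmem v)
        ((ht u hu).trans (ht v hv).symm) ha hb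
    have hkt := hk t
    simp only [Finset.sum_const_zero, zero_add] at hkt
    have h1 := Set.ncard_le_ncard hsub
    have h2 := Set.ncard_union_le (({a ∈ A | p a ∉ A ∧ rep (p a) = t} : Finset V) : Set V)
      {a | a ∈ A ∧ ∃ u ∈ c.supp, p u = a}
    rw [Set.ncard_coe_finset] at h2
    omega
end

section
/- Let V be a finite set and let E ⊆ V × V be a set of m directed edges. A directed path is a sequence v_0, v_1, …, v_s of vertices with (v_{i−1}, v_i) ∈ E for all 1 ≤ i ≤ s; it contains s+1 vertices. Suppose that δ ≥ 1 is an integer and every directed path contains at most 2^δ vertices (in particular the graph is acyclic). Then for every integer r with 1 ≤ r ≤ δ there exists a set R ⊆ E with δ·|R| ≤ r·m such that every directed path all of whose edges lie in E \ R contains at most 2^{δ−r} vertices. -/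
/-- The natural number obtained from `x` by deleting its `i`-th binary digit. -/
def deleteBit : ℕ → ℕ → ℕ
  | 0, x => x / 2
  | i + 1, x => 2 * deleteBit i (x / 2) + x % 2

theorem deleteBit_lt (i : ℕ) : ∀ {k x : ℕ}, i ≤ k → x < 2 ^ (k + 1) → deleteBit i x < 2 ^ k := by
  induction i with
  | zero =>
    intro k x _ hx
    rw [pow_succ] at hx
    simp only [deleteBit]
    omega
  | succ i ih =>
    intro k x hik hx
    obtain ⟨k, rfl⟩ : ∃ l, k = l + 1 := ⟨k - 1, by omega⟩
    have := ih (k := k) (x := x / 2) (by omega) (by rw [pow_succ] at hx; omega)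
    rw [pow_succ]
    simp only [deleteBit]
    omega

/-- If `x < y`, deleting a common binary digit preserves the inequality unless it is the leading
digit where they differ. -/
theorem exists_forall_ne_deleteBit_lt (k : ℕ) : ∀ {x y : ℕ}, x < y → y < 2 ^ k →
    ∃ j < k, ∀ i, i ≠ j → deleteBit i x < deleteBit i y := by
  induction k with
  | zero => intro x y hxy hy; simp at hy; omega
  | succ k ih =>
    intro x y hxy hy
    rw [pow_succ] at hy
    rcases (Nat.div_le_div_right (c := 2) hxy.le).lt_or_eq with h | h
    · obtain ⟨j, hj, hlt⟩ := ih h (by omega)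
      refine ⟨j + 1, by omega, fun i hi ↦ ?_⟩
      cases i with
      | zero => exact h
      | succ i =>
        have := hlt i (by omega)
        simp only [deleteBit]
        omega
    · refine ⟨0, by omega, fun i hi ↦ ?_⟩
      cases i with
      | zero => exact absurd rfl hi
      | succ i =>
        simp only [deleteBit, h]
        omega

theorem Finset.exists_card_mul_card_fiber_le {α : Type*} (E : Finset α) {k : ℕ} (hk : 0 < k)
    (c : α → ℕ) (hc : ∀ e ∈ E, c e < k) : ∃ j < k, k * (E.filter (c · = j)).card ≤ E.card := by
  obtain ⟨j, hj, hmin⟩ := Finset.exists_min_image (Finset.range k)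
    (fun j ↦ (E.filter (c · = j)).card) ⟨0, by simpa using hk⟩
  refine ⟨j, by simpa using hj, ?_⟩
  rw [Finset.card_eq_sum_card_fiberwise (s := E) (f := c) (t := Finset.range k)
    (fun e he ↦ by simpa using hc e he)]
  simpa using Finset.card_nsmul_le_sum (Finset.range k) _ _ hmin

/-- Removing a `1 / (k + 1)` fraction of the edges halves the range of an increasing labelling. -/
theorem exists_labelling_of_remove_fiber {V : Type*} [DecidableEq V] (E : Finset (V × V)) (k : ℕ)
    (l : V → ℕ) (hl : ∀ v, l v < 2 ^ (k + 1)) (hE : ∀ e ∈ E, l e.1 < l e.2) :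
    ∃ R ⊆ E, (k + 1) * R.card ≤ E.card ∧
      ∃ l' : V → ℕ, (∀ v, l' v < 2 ^ k) ∧ ∀ e ∈ E \ R, l' e.1 < l' e.2 := by
  have h (e : V × V) : ∃ j, e ∈ E →
      j < k + 1 ∧ ∀ i, i ≠ j → deleteBit i (l e.1) < deleteBit i (l e.2) := by
    by_cases he : e ∈ E
    · obtain ⟨j, hj⟩ := exists_forall_ne_deleteBit_lt (k + 1) (hE e he) (hl e.2)
      exact ⟨j, fun _ ↦ hj⟩
    · exact ⟨0, fun h ↦ absurd h he⟩
  choose c hc using h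
  obtain ⟨j, hj, hcard⟩ :=
    E.exists_card_mul_card_fiber_le k.succ_pos c fun e he ↦ (hc e he).1
  refine ⟨_, Finset.filter_subset _ _, hcard, fun v ↦ deleteBit j (l v),
    fun v ↦ deleteBit_lt j (by omega) (hl v), fun e he ↦ ?_⟩
  simp only [Finset.mem_sdiff, Finset.mem_filter, not_and] at he
  exact (hc e he.1).2 j (Ne.symm (he.2 he.1))

theorem exists_labelling_of_remove {V : Type*} [DecidableEq V] (r : ℕ) :
    ∀ (E : Finset (V × V)) (k : ℕ) (l : V → ℕ), r ≤ k → (∀ v, l v < 2 ^ k) →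
      (∀ e ∈ E, l e.1 < l e.2) →
      ∃ R ⊆ E, k * R.card ≤ r * E.card ∧
        ∃ l' : V → ℕ, (∀ v, l' v < 2 ^ (k - r)) ∧ ∀ e ∈ E \ R, l' e.1 < l' e.2 := by
  induction r with
  | zero => exact fun E k l _ hl hE ↦ ⟨∅, by simp, by simp, l, by simpa using hl, by simpa using hE⟩
  | succ q ih =>
    intro E k l hk hl hE
    obtain ⟨k, rfl⟩ : ∃ n, k = n + 1 := ⟨k - 1, by omega⟩
    obtain ⟨R, hR, hRcard, l₁, hl₁, hE₁⟩ := exists_labelling_of_remove_fiber E k l hl hE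
    obtain ⟨S, hS, hScard, l₂, hl₂, hE₂⟩ := ih (E \ R) k l₁ (by omega) hl₁ hE₁
    have hRS : R ∪ S ⊆ E := Finset.union_subset hR (hS.trans Finset.sdiff_subset)
    refine ⟨R ∪ S, hRS, ?_, l₂, by simpa using hl₂, ?_⟩
    · rcases k.eq_zero_or_pos with rfl | hpos
      · obtain rfl : q = 0 := by omega
        simpa using Finset.card_le_card hRS
      · have hu := Finset.card_union_le R S
        have hd := Finset.card_sdiff_add_card_eq_card hR
        obtain ⟨d, rfl⟩ : ∃ d, k = q + d := ⟨k - q, by omega⟩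
        refine Nat.le_of_mul_le_mul_left (?_ : (q + d) * _ ≤ (q + d) * _) hpos
        calc (q + d) * ((q + d + 1) * (R ∪ S).card)
            ≤ (q + d) * ((q + d + 1) * (R.card + S.card)) := by gcongr
          _ = (q + d) * ((q + d + 1) * R.card) + (q + d + 1) * ((q + d) * S.card) := by ring
          _ ≤ (q + d) * ((q + d + 1) * R.card) + (q + d + 1) * (q * (E \ R).card) := by gcongr
          _ = d * ((q + d + 1) * R.card) + (q + d + 1) * (q * E.card) := by rw [← hd]; ring
          _ ≤ d * E.card + (q + d + 1) * (q * E.card) := by gcongr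
          _ = (q + d) * ((q + 1) * E.card) := by ring
    · rwa [sdiff_sdiff_left] at hE₂

/-- If all paths have at most `N` vertices, the length of a longest path ending at a vertex is an
increasing labelling with values below `N`. -/
theorem exists_labelling_of_depth_le {V : Type*} (E : Finset (V × V)) (N : ℕ) (hN : 0 < N)
    (hdepth : ∀ (s : ℕ) (p : ℕ → V), (∀ i < s, (p i, p (i + 1)) ∈ E) → s + 1 ≤ N) :
    ∃ l : V → ℕ, (∀ v, l v < N) ∧ ∀ e ∈ E, l e.1 < l e.2 := by
  classical
  let P (v : V) (s : ℕ) : Prop := ∃ p : ℕ → V, (∀ i < s, (p i, p (i + 1)) ∈ E) ∧ p s = v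
  refine ⟨fun v ↦ Nat.findGreatest (P v) (N - 1), fun v ↦ ?_, fun ⟨u, v⟩ he ↦ ?_⟩
  · have := Nat.findGreatest_le (P := P v) (N - 1)
    exact this.trans_lt (by omega)
  · obtain ⟨p, hp, hpu⟩ : P u (Nat.findGreatest (P u) (N - 1)) :=
      Nat.findGreatest_spec (m := 0) (Nat.zero_le _) ⟨fun _ ↦ u, by simp, rfl⟩
    dsimp only
    generalize Nat.findGreatest (P u) (N - 1) = s at hp hpu ⊢
    have hq : ∀ i < s + 1, ((if i ≤ s then p i else v), if i + 1 ≤ s then p (i + 1) else v) ∈ E := by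
      intro i hi
      rcases (Nat.lt_succ_iff.mp hi).lt_or_eq with h | rfl
      · simpa [h.le, Nat.succ_le_of_lt h] using hp i h
      · simpa [hpu] using he
    have hs := hdepth (s + 1) (fun i ↦ if i ≤ s then p i else v) hq
    exact Nat.le_findGreatest (by omega) ⟨_, hq, by simp⟩

theorem le_labelling_of_path {V : Type*} {E : Finset (V × V)} {l : V → ℕ}
    (hE : ∀ e ∈ E, l e.1 < l e.2) (s : ℕ) (p : ℕ → V)
    (hp : ∀ i < s, (p i, p (i + 1)) ∈ E) : s ≤ l (p s) := by
  induction s with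
  | zero => exact Nat.zero_le _
  | succ s ih =>
    exact (ih fun i hi ↦ hp i (by omega)).trans_lt (hE _ (hp s (by omega)))

/-- Valiant's depth-reduction lemma: let `(V, E)` be a directed graph with `m`
edges in which every directed path (a sequence of vertices where each
consecutive pair is an edge) contains at most `2^δ` vertices, where `δ ≥ 1`.
Then for every `1 ≤ r ≤ δ` there is a set `R ⊆ E` with `δ·|R| ≤ r·m` such that
every directed path all of whose edges lie in `E \ R` contains at most
`2^{δ−r}` vertices. -/
theorem stmt13 {V : Type*} [Fintype V] [DecidableEq V]
    (E : Finset (V × V)) (δ : ℕ) (hδ : 1 ≤ δ)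
    (hdepth : ∀ (s : ℕ) (p : ℕ → V),
      (∀ i < s, (p i, p (i + 1)) ∈ E) → s + 1 ≤ 2 ^ δ) :
    ∀ r, 1 ≤ r → r ≤ δ →
      ∃ R ⊆ E, δ * R.card ≤ r * E.card ∧
        ∀ (s : ℕ) (p : ℕ → V),
          (∀ i < s, (p i, p (i + 1)) ∈ E \ R) → s + 1 ≤ 2 ^ (δ - r) := by
  intro r _ hr
  obtain ⟨l, hl, hE⟩ := exists_labelling_of_depth_le E (2 ^ δ) (by positivity) hdepth
  obtain ⟨R, hR, hcard, l', hl', hE'⟩ := exists_labelling_of_remove r E δ l hr hl hE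
  exact ⟨R, hR, hcard, fun s p hp ↦ (le_labelling_of_path hE' s p hp).trans_lt (hl' _)⟩
end

section
/- Let d, k ∈ ℕ with 2 ≤ d ≤ k, let V be a finite set of variables partitioned into parts V_1,…,V_k, let C_1,…,C_m be d-clauses over V, and let t ∈ ℕ. Define the d-hypergraph H whose vertex set is the disjoint union of the sets P_i = {(i, y) : y is a function V_i → {0,1}} for i = 1,…,k, and whose edge set consists of all sets f of vertices with |f| ≤ d whose elements have pairwise distinct first coordinates; for an edge f = {(i_1,y_1),…,(i_ℓ,y_ℓ)} (with i_1,…,i_ℓ pairwise distinct) define the weight w(f) to be −1 times the number of indices j ∈ {1,…,m} such that (1) vars(C_j) ⊆ V_{i_1} ∪ ⋯ ∪ V_{i_ℓ}, (2) vars(C_j) ∩ V_{i_s} ≠ ∅ for every s ∈ {1,…,ℓ}, and (3) the assignment of V_{i_1} ∪ ⋯ ∪ V_{i_ℓ} given by y_1,…,y_ℓ satisfies C_j. Then H has a k-clique of weight at most −t if and only if there exists an assignment x : V → {0,1} that satisfies at least t of the clauses C_1,…,C_m. -/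
/-- The vertex set of the hypergraph `H`: the disjoint union of the sets
`P_i = {(i, y) : y an assignment of the variables in part i}`, where an
assignment of part `i` is represented by a function `α → Bool` that is `false`
outside of part `i`. -/
def maxSatVerts {α : Type*} [Fintype α] [DecidableEq α] (k : ℕ)
    (P : Fin k → Finset α) : Finset (Fin k × (α → Bool)) :=
  Finset.univ.filter (fun p => ∀ x, x ∉ P p.1 → p.2 x = false)

/-- The edge set of `H`: all sets of vertices of size at most `d` whose
elements have pairwise distinct first coordinates. -/
def maxSatEdges {α : Type*} [Fintype α] [DecidableEq α] (d k : ℕ)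
    (P : Fin k → Finset α) : Finset (Finset (Fin k × (α → Bool))) :=
  (maxSatVerts k P).powerset.filter
    (fun f => f.card ≤ d ∧ ∀ p ∈ f, ∀ q ∈ f, Prod.fst p = Prod.fst q → p = q)

/-- The weight of an edge `f` of `H`: `−1` times the number of clauses `C_j`
(given as pairs of positive/negative literal sets) such that (1) `vars(C_j)` is
contained in the union of the parts touched by `f`, (2) `vars(C_j)` meets every
part touched by `f`, and (3) the combined assignment given by `f` satisfies
`C_j`. -/
def maxSatWeight {α : Type*} [Fintype α] [DecidableEq α] (k m : ℕ)
    (P : Fin k → Finset α) (Cl : Fin m → Finset α × Finset α)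
    (f : Finset (Fin k × (α → Bool))) : ℤ :=
  -((Finset.univ.filter (fun j : Fin m =>
      ((Cl j).1 ∪ (Cl j).2) ⊆ (f.image Prod.fst).biUnion P ∧
      (∀ i ∈ f.image Prod.fst, (((Cl j).1 ∪ (Cl j).2) ∩ P i).Nonempty) ∧
      ((∃ v ∈ (Cl j).1, ∃ p ∈ f, v ∈ P p.1 ∧ p.2 v = true) ∨
        (∃ v ∈ (Cl j).2, ¬ ∃ p ∈ f, v ∈ P p.1 ∧ p.2 v = true)))).card : ℤ)

/-- The vertices of `S` lying in a part that meets the variable set `W`. -/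
def touchedVerts {α : Type*} [DecidableEq α] {k : ℕ} (P : Fin k → Finset α)
    (S : Finset (Fin k × (α → Bool))) (W : Finset α) : Finset (Fin k × (α → Bool)) :=
  S.filter (fun p => (W ∩ P p.1).Nonempty)

theorem card_touchedVerts_le {α : Type*} [DecidableEq α] {k : ℕ} {P : Fin k → Finset α}
    (hdisj : ∀ i j, i ≠ j → Disjoint (P i) (P j)) {S : Finset (Fin k × (α → Bool))}
    (hinj : ∀ p ∈ S, ∀ q ∈ S, p.1 = q.1 → p = q) (W : Finset α) :
    (touchedVerts P S W).card ≤ W.card := by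
  refine Finset.card_le_card_of_forall_subsingleton (fun p v => v ∈ P p.1) (fun p hp => ?_)
    fun v _ p hp q hq => ?_
  · obtain ⟨v, hv⟩ := (Finset.mem_filter.1 hp).2
    exact ⟨v, Finset.mem_inter.1 hv⟩
  · refine hinj p (Finset.mem_filter.1 hp.1).1 q (Finset.mem_filter.1 hq.1).1 ?_
    by_contra hne
    exact Finset.disjoint_left.1 (hdisj _ _ hne) hp.2 hq.2

theorem eq_touchedVerts {α : Type*} [DecidableEq α] {k : ℕ} {P : Fin k → Finset α}
    (hdisj : ∀ i j, i ≠ j → Disjoint (P i) (P j)) {S : Finset (Fin k × (α → Bool))}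
    (hinj : ∀ p ∈ S, ∀ q ∈ S, p.1 = q.1 → p = q) {W : Finset α}
    {f : Finset (Fin k × (α → Bool))} (hfS : f ⊆ S) (hW : W ⊆ (f.image Prod.fst).biUnion P)
    (hmeet : ∀ i ∈ f.image Prod.fst, (W ∩ P i).Nonempty) :
    f = touchedVerts P S W := by
  ext p
  refine ⟨fun hp => Finset.mem_filter.2 ⟨hfS hp, hmeet _ (Finset.mem_image_of_mem _ hp)⟩,
    fun hp => ?_⟩
  obtain ⟨hpS, v, hv⟩ := Finset.mem_filter.1 hp
  obtain ⟨hvW, hvp⟩ := Finset.mem_inter.1 hv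
  obtain ⟨i, hi, hvi⟩ := Finset.mem_biUnion.1 (hW hvW)
  obtain ⟨q, hq, rfl⟩ := Finset.mem_image.1 hi
  have hqp : q.1 = p.1 := by
    by_contra hne
    exact Finset.disjoint_left.1 (hdisj _ _ hne) hvi hvp
  exact hinj q (hfS hq) p hpS hqp ▸ hq

/-- The assignment obtained by gluing the partial assignments in `S`. -/
def glueAssignment {α : Type*} [DecidableEq α] {k : ℕ} (P : Fin k → Finset α)
    (S : Finset (Fin k × (α → Bool))) (v : α) : Bool :=
  decide (∃ p ∈ S, v ∈ P p.1 ∧ p.2 v = true)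

theorem exists_mem_touchedVerts_iff {α : Type*} [DecidableEq α] {k : ℕ} {P : Fin k → Finset α}
    {S : Finset (Fin k × (α → Bool))} {W : Finset α} {v : α} (hv : v ∈ W) :
    (∃ p ∈ touchedVerts P S W, v ∈ P p.1 ∧ p.2 v = true) ↔ glueAssignment P S v = true := by
  simp only [glueAssignment, decide_eq_true_eq, touchedVerts, Finset.mem_filter]
  constructor
  · rintro ⟨p, ⟨hp, -⟩, h⟩
    exact ⟨p, hp, h⟩
  · rintro ⟨p, hp, h⟩
    exact ⟨p, ⟨hp, v, Finset.mem_inter.2 ⟨hv, h.1⟩⟩, h⟩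

theorem sum_maxSatWeight_eq {α : Type*} [Fintype α] [DecidableEq α] {d k m : ℕ}
    {P : Fin k → Finset α} (hdisj : ∀ i j, i ≠ j → Disjoint (P i) (P j))
    {Cl : Fin m → Finset α × Finset α}
    (hsub : ∀ j, (Cl j).1 ∪ (Cl j).2 ⊆ Finset.univ.biUnion P)
    (hcard : ∀ j, (Cl j).1.card + (Cl j).2.card ≤ d)
    {S : Finset (Fin k × (α → Bool))} (hS : S ⊆ maxSatVerts k P)
    (hinj : ∀ p ∈ S, ∀ q ∈ S, p.1 = q.1 → p = q) (hsurj : ∀ i, ∃ p ∈ S, p.1 = i) :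
    ∑ f ∈ (maxSatEdges d k P).filter (fun f => f ⊆ S), maxSatWeight k m P Cl f =
      -((Finset.univ.filter (fun j : Fin m =>
        (∃ v ∈ (Cl j).1, glueAssignment P S v = true) ∨
          (∃ v ∈ (Cl j).2, glueAssignment P S v = false))).card : ℤ) := by
  have hsat : ∀ j, ((∃ v ∈ (Cl j).1, ∃ p ∈ touchedVerts P S ((Cl j).1 ∪ (Cl j).2),
        v ∈ P p.1 ∧ p.2 v = true) ∨
      (∃ v ∈ (Cl j).2, ¬ ∃ p ∈ touchedVerts P S ((Cl j).1 ∪ (Cl j).2),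
        v ∈ P p.1 ∧ p.2 v = true)) ↔
      ((∃ v ∈ (Cl j).1, glueAssignment P S v = true) ∨
        (∃ v ∈ (Cl j).2, glueAssignment P S v = false)) := by
    intro j
    refine or_congr (exists_congr fun v => and_congr_right fun hv => ?_)
      (exists_congr fun v => and_congr_right fun hv => ?_)
    · exact exists_mem_touchedVerts_iff (Finset.mem_union_left _ hv)
    · rw [exists_mem_touchedVerts_iff (Finset.mem_union_right _ hv), Bool.not_eq_true]
  simp only [maxSatWeight, Finset.sum_neg_distrib, ← Nat.cast_sum, neg_inj, Nat.cast_inj]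
  rw [Finset.card_filter]
  simp only [Finset.card_filter]
  rw [Finset.sum_comm]
  refine Finset.sum_congr rfl fun j _ => ?_
  rw [Finset.sum_eq_single (touchedVerts P S ((Cl j).1 ∪ (Cl j).2))]
  · refine if_congr ?_ rfl rfl
    rw [hsat]
    refine ⟨fun h => h.2.2, fun h => ⟨fun v hv => ?_, fun i hi => ?_, h⟩⟩
    · obtain ⟨i, -, hvi⟩ := Finset.mem_biUnion.1 (hsub j hv)
      obtain ⟨p, hp, rfl⟩ := hsurj i
      exact Finset.mem_biUnion.2 ⟨p.1, Finset.mem_image_of_mem _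
        (Finset.mem_filter.2 ⟨hp, v, Finset.mem_inter.2 ⟨hv, hvi⟩⟩), hvi⟩
    · obtain ⟨p, hp, rfl⟩ := Finset.mem_image.1 hi
      exact (Finset.mem_filter.1 hp).2
  · intro f hf hne
    refine if_neg fun h => hne ?_
    exact eq_touchedVerts hdisj hinj (Finset.mem_filter.1 hf).2 h.1 h.2.1
  · intro hnot
    have hTS : touchedVerts P S ((Cl j).1 ∪ (Cl j).2) ⊆ S := Finset.filter_subset _ _
    refine absurd (Finset.mem_filter.2 ⟨Finset.mem_filter.2
      ⟨Finset.mem_powerset.2 (hTS.trans hS), ?_, ?_⟩, hTS⟩) hnot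
    · exact (card_touchedVerts_le hdisj hinj _).trans
        ((Finset.card_union_le _ _).trans (hcard j))
    · exact fun p hp q hq => hinj p (hTS hp) q (hTS hq)

/-- The vertices of `H` obtained by restricting an assignment to the parts. -/
def restrictVerts {α : Type*} [Fintype α] [DecidableEq α] {k : ℕ} (P : Fin k → Finset α)
    (x : α → Bool) : Finset (Fin k × (α → Bool)) :=
  Finset.univ.image (fun i => (i, fun v => decide (v ∈ P i) && x v))

theorem glueAssignment_restrictVerts {α : Type*} [Fintype α] [DecidableEq α] {k : ℕ} {P : Fin k → Finset α}
    (x : α → Bool) {v : α} (hv : v ∈ Finset.univ.biUnion P) :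
    glueAssignment P (restrictVerts P x) v = x v := by
  obtain ⟨i, -, hi⟩ := Finset.mem_biUnion.1 hv
  rw [Bool.eq_iff_iff]
  simp only [glueAssignment, restrictVerts, decide_eq_true_eq, Finset.mem_image,
    Finset.mem_univ, true_and]
  constructor
  · rintro ⟨p, ⟨l, rfl⟩, hl, h⟩
    simpa [hl] using h
  · intro h
    exact ⟨_, ⟨i, rfl⟩, hi, by simpa [hi] using h⟩

/-- Correctness of the reduction from Max-`d`-SAT to Min-Weight-`k`-Clique on
`d`-hypergraphs: the hypergraph `H` (vertices `maxSatVerts`, edges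
`maxSatEdges`, weights `maxSatWeight`) has a `k`-clique of weight at most `−t`
iff there is an assignment satisfying at least `t` of the clauses
`C_1, …, C_m`. -/
theorem stmt14 {α : Type*} [Fintype α] [DecidableEq α] (d k m : ℕ)
    (hd : 2 ≤ d) (hdk : d ≤ k)
    (V : Finset α) (P : Fin k → Finset α)
    (hdisj : ∀ i j, i ≠ j → Disjoint (P i) (P j))
    (hcover : Finset.univ.biUnion P = V)
    (Cl : Fin m → Finset α × Finset α)
    (hCl : ∀ j, Disjoint (Cl j).1 (Cl j).2 ∧ ((Cl j).1 ∪ (Cl j).2) ⊆ V ∧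
      (Cl j).1.card + (Cl j).2.card ≤ d)
    (t : ℕ) :
    (∃ S ⊆ maxSatVerts k P, S.card = k ∧
        (∀ f ⊆ S, f.card ≤ d → f ∈ maxSatEdges d k P) ∧
        ∑ f ∈ (maxSatEdges d k P).filter (fun f => f ⊆ S),
          maxSatWeight k m P Cl f ≤ -(t : ℤ)) ↔
      ∃ x : α → Bool, t ≤ (Finset.univ.filter (fun j : Fin m =>
        (∃ v ∈ (Cl j).1, x v = true) ∨ (∃ v ∈ (Cl j).2, x v = false))).card := by
  have hsub : ∀ j, (Cl j).1 ∪ (Cl j).2 ⊆ Finset.univ.biUnion P := fun j => hcover ▸ (hCl j).2.1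
  have hcard := fun j => (hCl j).2.2
  constructor
  · rintro ⟨S, hS, hSk, hcl, hw⟩
    have hinj : ∀ p ∈ S, ∀ q ∈ S, p.1 = q.1 → p = q := by
      intro p hp q hq
      have hpq : ({p, q} : Finset _) ⊆ S := by
        simp [Finset.insert_subset_iff, hp, hq]
      have hedge := hcl {p, q} hpq (Finset.card_le_two.trans hd)
      exact (Finset.mem_filter.1 hedge).2.2 p (by simp) q (by simp)
    have himage : S.image Prod.fst = Finset.univ := by
      rw [← Finset.card_eq_iff_eq_univ, Finset.card_image_of_injOn fun p hp q hq => hinj p hp q hq,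
        hSk, Fintype.card_fin]
    have hsurj : ∀ i, ∃ p ∈ S, p.1 = i := fun i =>
      Finset.mem_image.1 (himage ▸ Finset.mem_univ i)
    rw [sum_maxSatWeight_eq hdisj hsub hcard hS hinj hsurj] at hw
    exact ⟨glueAssignment P S, by omega⟩
  · rintro ⟨x, hx⟩
    have hS : restrictVerts P x ⊆ maxSatVerts k P := by
      intro p hp
      obtain ⟨i, -, rfl⟩ := Finset.mem_image.1 hp
      simp +contextual [maxSatVerts]
    have hinj : ∀ p ∈ restrictVerts P x, ∀ q ∈ restrictVerts P x, p.1 = q.1 → p = q := by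
      intro p hp q hq h
      obtain ⟨i, -, rfl⟩ := Finset.mem_image.1 hp
      obtain ⟨l, -, rfl⟩ := Finset.mem_image.1 hq
      obtain rfl : i = l := h
      rfl
    have hsurj : ∀ i, ∃ p ∈ restrictVerts P x, p.1 = i := fun i =>
      ⟨_, Finset.mem_image_of_mem _ (Finset.mem_univ i), rfl⟩
    refine ⟨restrictVerts P x, hS, ?_, fun f hf hfd => ?_, ?_⟩
    · rw [restrictVerts, Finset.card_image_of_injective _ fun i l h => congrArg Prod.fst h,
        Finset.card_univ, Fintype.card_fin]
    · exact Finset.mem_filter.2 ⟨Finset.mem_powerset.2 (hf.trans hS), hfd,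
        fun p hp q hq => hinj p (hf hp) q (hf hq)⟩
    · rw [sum_maxSatWeight_eq hdisj hsub hcard hS hinj hsurj, neg_le_neg_iff, Nat.cast_le]
      refine hx.trans (Finset.card_le_card fun j hj => ?_)
      refine Finset.mem_filter.2 ⟨Finset.mem_univ j, (Finset.mem_filter.1 hj).2.imp ?_ ?_⟩
      · rintro ⟨v, hv, h⟩
        exact ⟨v, hv, by rwa [glueAssignment_restrictVerts x (hsub j (Finset.mem_union_left _ hv))]⟩
      · rintro ⟨v, hv, h⟩
        exact ⟨v, hv, by rwa [glueAssignment_restrictVerts x (hsub j (Finset.mem_union_right _ hv))]⟩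
end
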